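/- arXiv:1904.06245 — 2 statements merged into one kernel-verified Lean document; each statement's English description precedes it below -/
import Mathlib

section
/- There is an absolute constant C such that the following holds. Let 𝒬 = {Q_1, …, Q_m} be a set of pairwise linearly independent homogeneous quadratic polynomials in ℂ[x_1, …, x_n], each either irreducible or the square of a linear form, such that for every i ≠ j there exists k ∉ {i, j} with Q_k vanishing at every common zero of Q_i and Q_j. Let Q ∈ 𝒬 be irreducible, and let F_1, …, F_{m'} ∈ 𝒬 be such that for each i there exist linear forms c_{i,1}, c_{i,2} with the property that both Q and F_i vanish at every point a ∈ ℂⁿ with c_{i,1}(a) = c_{i,2}(a) = 0. Then there exists a ℂ-subspace V of the space of linear forms with dim V ≤ C such that every F_i is a quadratic over V. -/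
open MvPolynomial

/-- A family of nonzero, pairwise non-proportional vectors such that the plane spanned by any two
of them contains a third one. -/
structure IsSylvesterGallai {ι E : Type*} [AddCommGroup E] [Module ℂ E] (v : ι → E) : Prop where
  ne_zero : ∀ i, v i ≠ 0
  not_proportional : ∀ i j, i ≠ j → ∀ c : ℂ, v i ≠ c • v j
  exists_third : ∀ i j, i ≠ j → ∃ k, k ≠ i ∧ k ≠ j ∧ ∃ a b : ℂ, v k = a • v i + b • v j

namespace IsSylvesterGallai

section Combinatorics

variable {ι E : Type*} [AddCommGroup E] [Module ℂ E] {v : ι → E}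

theorem exists_third_ne_zero (h : IsSylvesterGallai v) {i j : ι} (hij : i ≠ j) :
    ∃ k, k ≠ i ∧ k ≠ j ∧ ∃ a b : ℂ, a ≠ 0 ∧ b ≠ 0 ∧ v k = a • v i + b • v j := by
  obtain ⟨k, hki, hkj, a, b, hk⟩ := h.exists_third i j hij
  refine ⟨k, hki, hkj, a, b, ?_, ?_, hk⟩
  · rintro rfl
    exact h.not_proportional k j hkj b (by simpa using hk)
  · rintro rfl
    exact h.not_proportional k i hki a (by simpa using hk)

open Classical in
theorem two_mul_card_lt [Fintype ι] (h : IsSylvesterGallai v) (U : Submodule ℂ E) {j : ι}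
    (hj : v j ∉ U) :
    2 * (Finset.univ.filter fun i => v i ∈ U).card <
      (Finset.univ.filter fun i => v i ∈ U ⊔ Submodule.span ℂ {v j}).card := by
  have hne : ∀ i, v i ∈ U → i ≠ j := by rintro i hi rfl; exact hj hi
  have hex : ∀ i, ∃ k, v i ∈ U → k ≠ j ∧ ∃ a b : ℂ, a ≠ 0 ∧ b ≠ 0 ∧ v k = a • v i + b • v j := by
    intro i
    by_cases hi : v i ∈ U
    · obtain ⟨k, -, hkj, hk⟩ := h.exists_third_ne_zero (hne i hi)
      exact ⟨k, fun _ => ⟨hkj, hk⟩⟩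
    · exact ⟨i, fun h => absurd h hi⟩
  choose f hf using hex
  set A := Finset.univ.filter fun i => v i ∈ U with hA
  have hmemA : ∀ i, i ∈ A ↔ v i ∈ U := by simp [hA]
  have hfU : ∀ i ∈ A, v (f i) ∉ U := by
    intro i hi hfi
    obtain ⟨-, a, b, ha, hb, hk⟩ := hf i ((hmemA i).1 hi)
    refine hj ((U.smul_mem_iff hb).1 ?_)
    have : b • v j = v (f i) - a • v i := by rw [hk]; abel
    rw [this]
    exact U.sub_mem hfi (U.smul_mem _ ((hmemA i).1 hi))
  have hinj : Set.InjOn f A := by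
    intro i hi i' hi' hii
    obtain ⟨-, a, b, ha, hb, hk⟩ := hf i ((hmemA i).1 hi)
    obtain ⟨-, a', b', ha', hb', hk'⟩ := hf i' ((hmemA i').1 hi')
    rw [← hii] at hk'
    have hbb : b = b' := by
      by_contra hbb
      refine hj ((U.smul_mem_iff (sub_ne_zero.2 hbb)).1 ?_)
      have : (b - b') • v j = a' • v i' - a • v i := by
        rw [sub_smul, sub_eq_sub_iff_add_eq_add, add_comm, ← hk, hk', add_comm]
      rw [this]
      exact U.sub_mem (U.smul_mem _ ((hmemA i').1 hi')) (U.smul_mem _ ((hmemA i).1 hi))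
    subst hbb
    by_contra hne'
    refine h.not_proportional i i' hne' (a⁻¹ * a') ?_
    have : a • v i = a' • v i' := add_right_cancel (hk.symm.trans hk')
    rw [mul_smul, ← this, smul_smul, inv_mul_cancel₀ ha, one_smul]
  have hdisj : Disjoint A (A.image f) := by
    rw [Finset.disjoint_left]
    intro i hi hi'
    obtain ⟨i', hi'A, rfl⟩ := Finset.mem_image.1 hi'
    exact hfU i' hi'A ((hmemA _).1 hi)
  have hjnot : j ∉ A ∪ A.image f := by
    simp only [Finset.mem_union, Finset.mem_image, not_or, not_exists, not_and]
    exact ⟨fun hjA => hj ((hmemA j).1 hjA), fun i hi => (hf i ((hmemA i).1 hi)).1⟩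
  have hsub : insert j (A ∪ A.image f) ⊆
      Finset.univ.filter fun i => v i ∈ U ⊔ Submodule.span ℂ {v j} := by
    intro i hi
    have hjmem : v j ∈ U ⊔ Submodule.span ℂ {v j} :=
      Submodule.mem_sup_right (Submodule.mem_span_singleton_self _)
    simp only [Finset.mem_filter, Finset.mem_univ, true_and]
    simp only [Finset.mem_insert, Finset.mem_union, Finset.mem_image] at hi
    rcases hi with rfl | hi | ⟨i', hi', rfl⟩
    · exact hjmem
    · exact Submodule.mem_sup_left ((hmemA i).1 hi)
    · obtain ⟨-, a, b, ha, hb, hk⟩ := hf i' ((hmemA i').1 hi')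
      rw [hk]
      exact Submodule.add_mem _ (Submodule.smul_mem _ _
        (Submodule.mem_sup_left ((hmemA i').1 hi'))) (Submodule.smul_mem _ _ hjmem)
  have := Finset.card_le_card hsub
  rw [Finset.card_insert_of_notMem hjnot, Finset.card_union_of_disjoint hdisj,
    Finset.card_image_of_injOn hinj] at this
  omega

end Combinatorics

end IsSylvesterGallai

/-- A strengthening of Chebyshev's sum inequality when one sequence has increments at least `1`. -/
theorem chebyshev_sum_add_le (D : ℕ) (N x : ℕ → ℝ) (hN : ∀ k < D, N k + 1 ≤ N (k + 1))
    (hx : ∀ k < D, x k ≤ x (k + 1)) :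
    (∑ k ∈ Finset.range (D + 1), N k) * (∑ k ∈ Finset.range (D + 1), x k)
      + ∑ k ∈ Finset.range (D + 1), (x D - x k)
      ≤ (D + 1) * ∑ k ∈ Finset.range (D + 1), N k * x k := by
  have key : MonovaryOn (fun k => N k - if k = D then 1 else 0) x
      ↑(Finset.range (D + 1)) := by
    have h1 : MonotoneOn (fun k => N k - if k = D then 1 else 0) (Set.Iic D) := by
      refine monotoneOn_of_le_add_one Set.ordConnected_Iic ?_
      intro k _ _ hk
      have hk : k < D := hk
      have := hN k hk
      simp only [hk.ne, if_false]
      split_ifs <;> linarith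
    have h2 : MonotoneOn x (Set.Iic D) := by
      refine monotoneOn_of_le_add_one Set.ordConnected_Iic ?_
      intro k _ _ hk
      exact hx k hk
    have hset : (↑(Finset.range (D + 1)) : Set ℕ) = Set.Iic D := by
      ext; simp
    rw [hset]
    exact h1.monovaryOn h2
  have := key.sum_mul_sum_le_card_mul_sum
  simp only [Finset.sum_sub_distrib, sub_mul, Finset.card_range, ite_mul, one_mul, zero_mul,
    Finset.sum_ite_eq', Finset.mem_range, Nat.lt_succ_self, if_true, Finset.sum_const,
    nsmul_eq_mul] at this ⊢
  push_cast at this ⊢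
  linarith

namespace IsSylvesterGallai

variable {ι E : Type*} [AddCommGroup E] [Module ℂ E] {v : ι → E}

open Classical in
/-- A greedy choice of a basis: any weight function `x` on a spanning Sylvester-Gallai family admits
a basis whose average weight is at most the average weight of the family, with a quantitative
gain controlled by the spread of the weights on the basis. -/
theorem exists_light_basis [Fintype ι] [FiniteDimensional ℂ E] (h : IsSylvesterGallai v)
    (hspan : Submodule.span ℂ (Set.range v) = ⊤) {D : ℕ} (hD : Module.finrank ℂ E = D + 1)
    (x : ι → ℝ) :
    ∃ w : Fin (D + 1) → ι, LinearIndependent ℂ (v ∘ w) ∧ ∃ X : ℝ, (∀ k, x (w k) ≤ X) ∧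
      Fintype.card ι * ∑ k, x (w k) + ∑ k, (X - x (w k)) ≤ (D + 1) * ∑ i, x i := by
  have hex : ∀ U : Submodule ℂ E, U ≠ ⊤ → ∃ i, v i ∉ U ∧ ∀ j, v j ∉ U → x i ≤ x j := by
    intro U hU
    have hne : (Finset.univ.filter fun i => v i ∉ U).Nonempty := by
      by_contra hcon
      rw [Finset.not_nonempty_iff_eq_empty] at hcon
      apply hU
      rw [eq_top_iff, ← hspan, Submodule.span_le]
      rintro _ ⟨i, rfl⟩
      by_contra hi
      exact (Finset.eq_empty_iff_forall_notMem.1 hcon i) (by simpa using hi)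
    obtain ⟨i, hi, hmin⟩ := Finset.exists_min_image _ x hne
    exact ⟨i, by simpa using hi, fun j hj => hmin j (by simpa using hj)⟩
  obtain ⟨i₀, -⟩ := hex ⊥ (by
    intro hbt
    have := finrank_top ℂ E
    rw [← hbt, finrank_bot] at this
    omega)
  have hex' : ∀ U : Submodule ℂ E, ∃ i, U ≠ ⊤ → v i ∉ U ∧ ∀ j, v j ∉ U → x i ≤ x j := by
    intro U
    by_cases hU : U = ⊤
    · exact ⟨i₀, fun h => absurd hU h⟩
    · obtain ⟨i, hi⟩ := hex U hU
      exact ⟨i, fun _ => hi⟩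
  choose c hc using hex'
  set U : ℕ → Submodule ℂ E := fun k => (fun U => U ⊔ Submodule.span ℂ {v (c U)})^[k] ⊥ with hUdef
  have hU0 : U 0 = ⊥ := rfl
  have hUs : ∀ k, U (k + 1) = U k ⊔ Submodule.span ℂ {v (c (U k))} := by
    intro k
    simp only [hUdef, Function.iterate_succ_apply']
  have hle : ∀ k, U k ≤ U (k + 1) := fun k => by rw [hUs]; exact le_sup_left
  have hrank_le : ∀ k, Module.finrank ℂ (U k) ≤ k := by
    intro k
    induction k with
    | zero => simp [hU0]
    | succ k ih =>
      rw [hUs]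
      refine (Submodule.finrank_add_le_finrank_add_finrank _ _).trans ?_
      have := finrank_span_singleton (K := ℂ) (h.ne_zero (c (U k)))
      omega
  have hne : ∀ k, k ≤ D → U k ≠ ⊤ := by
    intro k hk htop
    have := hrank_le k
    rw [htop, finrank_top, hD] at this
    omega
  have hspanw : ∀ k, U k ≤ Submodule.span ℂ ((fun m => v (c (U m))) '' Set.Iio k) := by
    intro k
    induction k with
    | zero => simp [hU0]
    | succ k ih =>
      rw [hUs]
      refine sup_le (ih.trans (Submodule.span_mono (Set.image_mono fun m hm => ?_))) ?_
      · exact lt_trans hm (Nat.lt_succ_self k)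
      · rw [Submodule.span_singleton_le_iff_mem]
        exact Submodule.subset_span ⟨k, Nat.lt_succ_self k, rfl⟩
  have hrank_ge : ∀ k, k ≤ D + 1 → k ≤ Module.finrank ℂ (U k) := by
    intro k
    induction k with
    | zero => simp
    | succ k ih =>
      intro hk
      have h1 := ih (by omega)
      have h2 : U k < U (k + 1) := by
        refine lt_of_le_of_ne (hle k) fun heq => (hc (U k) (hne k (by omega))).1 (heq.ge ?_)
        rw [hUs]
        exact Submodule.mem_sup_right (Submodule.mem_span_singleton_self _)
      have := Submodule.finrank_lt_finrank_of_lt h2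
      omega
  have hUtop : U (D + 1) = ⊤ :=
    Submodule.eq_top_of_finrank_eq (le_antisymm (Submodule.finrank_le _)
      (by rw [hD]; exact hrank_ge _ le_rfl))
  set n : ℕ → ℕ := fun k => (Finset.univ.filter fun i => v i ∈ U k).card with hn
  have hn0 : n 0 = 0 := by simp [hn, hU0, h.ne_zero]
  have hnD : n (D + 1) = Fintype.card ι := by simp [hn, hUtop]
  have hdouble : ∀ k ≤ D, 2 * n k < n (k + 1) := by
    intro k hk
    simp only [hn]
    rw [hUs]
    exact h.two_mul_card_lt _ (hc (U k) (hne k hk)).1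
  set y : ℕ → ℝ := fun k => x (c (U k)) with hy
  have hmono : ∀ k < D, y k ≤ y (k + 1) := by
    intro k hk
    exact (hc (U k) (hne k hk.le)).2 _ fun hmem =>
      (hc (U (k + 1)) (hne (k + 1) hk)).1 (hle k hmem)
  have hsum : ∀ k ≤ D + 1, ∑ m ∈ Finset.range k, ((n (m + 1) : ℝ) - n m) * y m ≤
      ∑ i ∈ Finset.univ.filter (fun i => v i ∈ U k), x i := by
    intro k
    induction k with
    | zero => simp [hU0, h.ne_zero]
    | succ k ih =>
      intro hk
      have hsub : (Finset.univ.filter fun i => v i ∈ U k) ⊆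
          Finset.univ.filter fun i => v i ∈ U (k + 1) := by
        intro i
        simp only [Finset.mem_filter, Finset.mem_univ, true_and]
        exact fun hi => hle k hi
      rw [Finset.sum_range_succ, ← Finset.sum_sdiff hsub, add_comm]
      refine add_le_add ?_ (ih (by omega))
      have hcard := Finset.card_sdiff_add_card_eq_card hsub
      have hcard' : ((n (k + 1) : ℝ) - n k) = ((Finset.univ.filter fun i => v i ∈ U (k + 1)) \
          (Finset.univ.filter fun i => v i ∈ U k)).card := by
        rw [sub_eq_iff_eq_add]
        exact_mod_cast hcard.symm
      rw [hcard', ← nsmul_eq_mul]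
      refine Finset.card_nsmul_le_sum _ _ _ fun i hi => ?_
      simp only [Finset.mem_sdiff, Finset.mem_filter, Finset.mem_univ, true_and] at hi
      exact (hc (U k) (hne k (by omega))).2 i hi.2
  have hcheb := chebyshev_sum_add_le D (fun k => (n (k + 1) : ℝ) - n k) y
    (fun k hk => by
      have h1 := hdouble k hk.le
      have h2 := hdouble (k + 1) hk
      have h3 : 2 * (n k : ℝ) + 1 ≤ n (k + 1) := by exact_mod_cast h1
      have h4 : 2 * (n (k + 1) : ℝ) + 1 ≤ n (k + 1 + 1) := by exact_mod_cast h2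
      have h5 : (0 : ℝ) ≤ n k := Nat.cast_nonneg _
      linarith) hmono
  rw [Finset.sum_range_sub (fun k => (n k : ℝ)), hnD, hn0] at hcheb
  refine ⟨fun k => c (U k), ?_, y D, ?_, ?_⟩
  · refine linearIndependent_of_top_le_span_of_card_eq_finrank ?_ (by simp [hD])
    rw [← hUtop]
    refine (hspanw (D + 1)).trans (Submodule.span_mono ?_)
    rintro _ ⟨m, hm, rfl⟩
    exact ⟨⟨m, hm⟩, rfl⟩
  · intro k
    have : MonotoneOn y (Set.Iic D) :=
      monotoneOn_of_le_add_one Set.ordConnected_Iic fun k _ _ hk => hmono k hk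
    exact this (Nat.lt_succ_iff.1 k.2) (Set.self_mem_Iic) (Nat.lt_succ_iff.1 k.2)
  · have h1 := hsum (D + 1) le_rfl
    simp only [hUtop, Submodule.mem_top, Finset.filter_true] at h1
    rw [Fin.sum_univ_eq_sum_range (fun k => x (c (U k))),
      Fin.sum_univ_eq_sum_range (fun k => y D - x (c (U k)))]
    have h2 : ((D : ℝ) + 1) * _ ≤ (D + 1) * _ := mul_le_mul_of_nonneg_left h1 (by positivity)
    simp only [Nat.cast_zero, sub_zero] at hcheb
    exact hcheb.trans h2

end IsSylvesterGallai

section Position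

open scoped InnerProductSpace

variable {ι E : Type*} [NormedAddCommGroup E] [InnerProductSpace ℂ E] [FiniteDimensional ℂ E]
  {v : ι → E}

/-- A scale-invariant potential on operators; its maximizers put the family `v` into radial
isotropic position. -/
noncomputable def radialPotential [Fintype ι] (v : ι → E) (A : E →L[ℂ] E) : ℝ :=
  Fintype.card ι * Real.log ‖A.det‖ - Module.finrank ℂ E * ∑ i, Real.log ‖A (v i)‖

theorem ContinuousLinearMap.apply_ne_zero_of_det_ne_zero {A : E →L[ℂ] E} (hA : A.det ≠ 0) {x : E}
    (hx : x ≠ 0) : A x ≠ 0 := by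
  intro h
  exact hx (((A : E →ₗ[ℂ] E).equivOfDetNeZero hA).map_eq_zero_iff.1 h)

theorem radialPotential_smul [Fintype ι] (hv : ∀ i, v i ≠ 0) {A : E →L[ℂ] E} (hA : A.det ≠ 0)
    {c : ℂ} (hc : c ≠ 0) : radialPotential v (c • A) = radialPotential v A := by
  have hdet : (c • A).det = c ^ Module.finrank ℂ E * A.det := by
    simp [ContinuousLinearMap.det, LinearMap.det_smul]
  have hc' : ‖c‖ ≠ 0 := norm_ne_zero_iff.2 hc
  have h1 : ∀ i, Real.log ‖(c • A) (v i)‖ = Real.log ‖c‖ + Real.log ‖A (v i)‖ := fun i => by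
    rw [_root_.smul_apply, norm_smul, Real.log_mul hc'
      (norm_ne_zero_iff.2 (ContinuousLinearMap.apply_ne_zero_of_det_ne_zero hA (hv i)))]
  simp only [radialPotential, h1, hdet, norm_mul, norm_pow, Finset.sum_add_distrib,
    Finset.sum_const, Finset.card_univ, nsmul_eq_mul]
  rw [Real.log_mul (pow_ne_zero _ hc') (norm_ne_zero_iff.2 hA), Real.log_pow]
  ring

theorem exists_log_norm_det_le [Fintype ι] {d : ℕ} (hd : Module.finrank ℂ E = d) (v : ι → E) :
    ∃ C : ℝ, ∀ A : E →L[ℂ] E, A.det ≠ 0 → ∀ w : Fin d → ι, LinearIndependent ℂ (v ∘ w) →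
      Real.log ‖A.det‖ ≤ ∑ k, Real.log ‖A (v (w k))‖ + C := by
  classical
  set b := Module.finBasisOfFinrankEq ℂ E hd
  have hcont : Continuous b.det.toMultilinearMap := by
    change Continuous fun m => b.det m
    simp only [Module.Basis.det_apply]
    refine Continuous.matrix_det (continuous_matrix fun i j => ?_)
    simp only [Module.Basis.toMatrix_apply]
    exact (b.coord i).continuous_of_finiteDimensional.comp (continuous_apply j)
  obtain ⟨C, hC, hbound⟩ := b.det.toMultilinearMap.exists_bound_of_continuous hcont
  refine ⟨Real.log C + ∑ w : Fin d → ι, |Real.log ‖b.det (v ∘ w)‖|, fun A hA w hw => ?_⟩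
  have h1 := hbound ((A : E →ₗ[ℂ] E) ∘ (v ∘ w))
  change ‖b.det ((A : E →ₗ[ℂ] E) ∘ (v ∘ w))‖ ≤ _ at h1
  rw [Module.Basis.det_comp, norm_mul] at h1
  have hvw : b.det (v ∘ w) ≠ 0 := by
    have hb := (Module.Basis.is_basis_iff_det b).1
      ⟨hw, hw.span_eq_top_of_card_eq_finrank' (by simp [hd])⟩
    exact hb.ne_zero
  have hne : ∀ k, ‖A (v (w k))‖ ≠ 0 := fun k => norm_ne_zero_iff.2
    (ContinuousLinearMap.apply_ne_zero_of_det_ne_zero hA (hw.ne_zero k))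
  have hdet : LinearMap.det (A : E →ₗ[ℂ] E) = A.det := rfl
  rw [hdet] at h1
  change _ ≤ C * ∏ k, ‖A (v (w k))‖ at h1
  have h2 := Real.log_le_log (by positivity) h1
  rw [Real.log_mul (norm_ne_zero_iff.2 hA) (norm_ne_zero_iff.2 hvw), Real.log_mul hC.ne'
    (Finset.prod_ne_zero_iff.2 fun k _ => hne k), Real.log_prod (fun k _ => hne k)] at h2
  have h3 : |Real.log ‖b.det (v ∘ w)‖| ≤ ∑ w : Fin d → ι, |Real.log ‖b.det (v ∘ w)‖| :=
    Finset.single_le_sum (f := fun w : Fin d → ι => |Real.log ‖b.det (v ∘ w)‖|)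
      (fun _ _ => abs_nonneg _) (Finset.mem_univ w)
  have h4 := neg_abs_le (Real.log ‖b.det (v ∘ w)‖)
  linarith

theorem exists_opNorm_le_of_linearIndependent [Fintype ι] {d : ℕ} (hd : Module.finrank ℂ E = d)
    (v : ι → E) :
    ∃ C : ℝ, 0 < C ∧ ∀ A : E →L[ℂ] E, ∀ w : Fin d → ι, LinearIndependent ℂ (v ∘ w) →
      ∀ M : ℝ, 0 ≤ M → (∀ k, ‖A (v (w k))‖ ≤ M) → ‖A‖ ≤ C * M := by
  classical
  have hex : ∀ w : Fin d → ι, ∃ C : ℝ, 0 < C ∧ (LinearIndependent ℂ (v ∘ w) →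
      ∀ A : E →L[ℂ] E, ∀ M : ℝ, 0 ≤ M → (∀ k, ‖A (v (w k))‖ ≤ M) → ‖A‖ ≤ C * M) := by
    intro w
    by_cases hw : LinearIndependent ℂ (v ∘ w)
    · have hspan := hw.span_eq_top_of_card_eq_finrank' (by simp [hd])
      obtain ⟨C, hC, h⟩ := (Module.Basis.mk hw hspan.ge).exists_opNorm_le (F := E)
      exact ⟨C, hC, fun _ A M hM hk => h hM (by simpa using hk)⟩
    · exact ⟨1, one_pos, fun h => absurd h hw⟩
  choose C hC h using hex
  refine ⟨1 + ∑ w, C w, add_pos_of_pos_of_nonneg one_pos (Finset.sum_nonneg fun w _ => (hC w).le),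
    fun A w hw M hM hk => (h w hw A M hM hk).trans (mul_le_mul_of_nonneg_right ?_ hM)⟩
  have := Finset.single_le_sum (fun w _ => (hC w).le) (Finset.mem_univ w)
  linarith

theorem IsSylvesterGallai.exists_norm_det_lower_bound [Fintype ι] (h : IsSylvesterGallai v)
    (hspan : Submodule.span ℂ (Set.range v) = ⊤) [Nontrivial E] [Nonempty ι] (c₀ : ℝ) :
    ∃ ε : ℝ, 0 < ε ∧ ∀ A : E →L[ℂ] E, A.det ≠ 0 → ‖A‖ = 1 → c₀ ≤ radialPotential v A →
      ε ≤ ‖A.det‖ := by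
  obtain ⟨D, hD⟩ : ∃ D, Module.finrank ℂ E = D + 1 :=
    Nat.exists_eq_succ_of_ne_zero Module.finrank_pos.ne'
  obtain ⟨C₁, hC₁⟩ := exists_log_norm_det_le hD v
  obtain ⟨C₃, hC₃, hnorm⟩ := exists_opNorm_le_of_linearIndependent hD v
  have hn : (0 : ℝ) < Fintype.card ι := by exact_mod_cast Fintype.card_pos
  set n : ℝ := (Fintype.card ι : ℝ)
  set C₂ : ℝ := n * C₁ - c₀
  refine ⟨Real.exp (c₀ / n + (D + 1) * (-Real.log C₃ - C₂)), Real.exp_pos _,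
    fun A hA hA1 hpot => ?_⟩
  obtain ⟨w, hw, X, hX, hsum⟩ := h.exists_light_basis hspan hD fun i => Real.log ‖A (v i)‖
  have hdet := hC₁ A hA w hw
  rw [radialPotential, hD] at hpot
  push_cast at hpot
  have hpos : ∀ k, 0 < ‖A (v (w k))‖ := fun k => norm_pos_iff.2
    (ContinuousLinearMap.apply_ne_zero_of_det_ne_zero hA (h.ne_zero _))
  have hXlow : -Real.log C₃ ≤ X := by
    have := hnorm A w hw (Real.exp X) (Real.exp_pos X).le
      fun k => (Real.log_le_iff_le_exp (hpos k)).1 (hX k)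
    rw [hA1] at this
    have := Real.log_le_log one_pos this
    rw [Real.log_one, Real.log_mul hC₃.ne' (Real.exp_pos X).ne', Real.log_exp] at this
    linarith
  have hdet' := mul_le_mul_of_nonneg_left hdet hn.le
  have hspread : ∑ k, (X - Real.log ‖A (v (w k))‖) ≤ C₂ := by
    simp only [C₂]
    linarith
  have hlow : ∀ k, -Real.log C₃ - C₂ ≤ Real.log ‖A (v (w k))‖ := by
    intro k
    have := Finset.single_le_sum (f := fun k => X - Real.log ‖A (v (w k))‖)
      (fun k _ => sub_nonneg.2 (hX k)) (Finset.mem_univ k)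
    linarith
  have hlow' : ((D : ℝ) + 1) * (-Real.log C₃ - C₂) ≤ ∑ k, Real.log ‖A (v (w k))‖ := by
    have := Finset.card_nsmul_le_sum Finset.univ _ _ fun k _ => hlow k
    simpa using this
  have hspread0 : 0 ≤ ∑ k, (X - Real.log ‖A (v (w k))‖) :=
    Finset.sum_nonneg fun k _ => sub_nonneg.2 (hX k)
  rw [← Real.le_log_iff_exp_le (norm_pos_iff.2 hA)]
  have hlow'' := mul_le_mul_of_nonneg_left hlow' hn.le
  refine le_of_mul_le_mul_left ?_ hn
  rw [mul_add, mul_div_cancel₀ _ hn.ne']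
  linarith

theorem IsSylvesterGallai.exists_radialPotential_max [Fintype ι] (h : IsSylvesterGallai v)
    (hspan : Submodule.span ℂ (Set.range v) = ⊤) [Nontrivial E] [Nonempty ι] :
    ∃ A : E →L[ℂ] E, A.det ≠ 0 ∧ ∀ B : E →L[ℂ] E, B.det ≠ 0 →
      radialPotential v B ≤ radialPotential v A := by
  have hdet1 : (1 : E →L[ℂ] E).det ≠ 0 := by simp [ContinuousLinearMap.det]
  obtain ⟨ε, hε, hlow⟩ := h.exists_norm_det_lower_bound hspan (radialPotential v 1)
  set K : Set (E →L[ℂ] E) := Metric.sphere 0 1 ∩ {A | ε ≤ ‖A.det‖} with hK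
  have : ProperSpace (E →L[ℂ] E) := FiniteDimensional.proper ℂ _
  have hKc : IsCompact K := (isCompact_sphere 0 1).inter_right
    (isClosed_le continuous_const ContinuousLinearMap.continuous_det.norm)
  have hKdet : ∀ A ∈ K, A.det ≠ 0 := fun A hA => norm_pos_iff.1 (hε.trans_le hA.2)
  have hmemK : ∀ A : E →L[ℂ] E, A.det ≠ 0 → ‖A‖ = 1 →
      radialPotential v 1 ≤ radialPotential v A → A ∈ K := fun A hA hA1 hpot =>
    ⟨by simpa using hA1, hlow A hA hA1 hpot⟩
  have h1K : (1 : E →L[ℂ] E) ∈ K := hmemK 1 hdet1 norm_one le_rfl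
  have hcont : ContinuousOn (radialPotential v) K := by
    refine (continuousOn_const.mul (ContinuousLinearMap.continuous_det.norm.continuousOn.log
      fun A hA => norm_ne_zero_iff.2 (hKdet A hA))).sub
      (continuousOn_const.mul (continuousOn_finsetSum _ fun i _ => ContinuousOn.log ?_
        fun A hA => norm_ne_zero_iff.2
          (ContinuousLinearMap.apply_ne_zero_of_det_ne_zero (hKdet A hA) (h.ne_zero i))))
    exact (ContinuousLinearMap.apply ℂ E (v i)).continuous.norm.continuousOn
  obtain ⟨A, hAK, hmax⟩ := hKc.exists_isMaxOn ⟨1, h1K⟩ hcont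
  refine ⟨A, hKdet A hAK, fun B hB => ?_⟩
  rcases le_total (radialPotential v B) (radialPotential v 1) with hle | hle
  · exact hle.trans (hmax h1K)
  · have hB0 : ‖B‖ ≠ 0 := by
      rw [norm_ne_zero_iff]
      rintro rfl
      obtain ⟨x, hx⟩ := exists_ne (0 : E)
      exact ContinuousLinearMap.apply_ne_zero_of_det_ne_zero hB hx rfl
    have hc : ((‖B‖⁻¹ : ℝ) : ℂ) ≠ 0 := by simpa using hB0
    have hpot := radialPotential_smul h.ne_zero hB hc
    rw [← hpot]
    refine hmax (hmemK _ ?_ ?_ (hpot ▸ hle))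
    · simp only [ContinuousLinearMap.det, ContinuousLinearMap.toLinearMap_smul, LinearMap.det_smul]
      exact mul_ne_zero (pow_ne_zero _ hc) hB
    · rw [norm_smul]
      simp [hB0]

end Position

section Kelly

open scoped InnerProductSpace

variable {ι E : Type*} [NormedAddCommGroup E] [InnerProductSpace ℂ E] {v : ι → E}

namespace IsSylvesterGallai

theorem map {E F : Type*} [AddCommGroup E] [Module ℂ E] [AddCommGroup F] [Module ℂ F] {v : ι → E}
    (h : IsSylvesterGallai v) (f : E →ₗ[ℂ] F) (hf : Function.Injective f) :
    IsSylvesterGallai (f ∘ v) where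
  ne_zero i := by simpa using (map_ne_zero_iff f hf).2 (h.ne_zero i)
  not_proportional i j hij c hc := h.not_proportional i j hij c (hf (by simpa using hc))
  exists_third i j hij := by
    obtain ⟨k, hki, hkj, a, b, hk⟩ := h.exists_third i j hij
    exact ⟨k, hki, hkj, a, b, by simp [hk]⟩

theorem smul {E : Type*} [AddCommGroup E] [Module ℂ E] {v : ι → E}
    (h : IsSylvesterGallai v) {c : ι → ℂ} (hc : ∀ i, c i ≠ 0) :
    IsSylvesterGallai fun i => c i • v i where
  ne_zero i := smul_ne_zero (hc i) (h.ne_zero i)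
  not_proportional i j hij a ha := by
    refine h.not_proportional i j hij ((c i)⁻¹ * a * c j) ?_
    rw [mul_assoc, mul_smul, mul_smul, ← ha, inv_smul_smul₀ (hc i)]
  exists_third i j hij := by
    obtain ⟨k, hki, hkj, a, b, hk⟩ := h.exists_third i j hij
    refine ⟨k, hki, hkj, c k * a * (c i)⁻¹, c k * b * (c j)⁻¹, ?_⟩
    rw [hk, smul_add, smul_smul, smul_smul, smul_smul, smul_smul,
      inv_mul_cancel_right₀ (hc i), inv_mul_cancel_right₀ (hc j)]

/-- Radial isotropic position of a Sylvester-Gallai family. -/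
theorem exists_isotropic [Fintype ι] [FiniteDimensional ℂ E] (h : IsSylvesterGallai v)
    (hspan : Submodule.span ℂ (Set.range v) = ⊤) [Nontrivial E] [Nonempty ι] :
    ∃ u : ι → E, IsSylvesterGallai u ∧ (∀ i, ‖u i‖ = 1) ∧
      ∀ e : E, ‖e‖ = 1 → Module.finrank ℂ E * ∑ i, ‖⟪e, u i⟫_ℂ‖ ^ 2 ≤ (Fintype.card ι : ℝ) := by
  obtain ⟨A, hA, hmax⟩ := h.exists_radialPotential_max hspan
  have hAv : ∀ i, ‖A (v i)‖ ≠ 0 := fun i => norm_ne_zero_iff.2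
    (ContinuousLinearMap.apply_ne_zero_of_det_ne_zero hA (h.ne_zero i))
  set u : ι → E := fun i => ((‖A (v i)‖⁻¹ : ℝ) : ℂ) • A (v i) with hu
  have hu1 : ∀ i, ‖u i‖ = 1 := fun i => by
    rw [hu, norm_smul]
    simp [hAv i]
  refine ⟨u, ?_, hu1, fun e he => ?_⟩
  · refine (h.map (A : E →ₗ[ℂ] E) fun x y hxy => ?_).smul (c := fun i => ((‖A (v i)‖⁻¹ : ℝ) : ℂ))
      fun i => by simpa using hAv i
    by_contra hne
    exact ContinuousLinearMap.apply_ne_zero_of_det_ne_zero hA (sub_ne_zero.2 hne)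
      (by rw [map_sub]; exact sub_eq_zero.2 hxy)
  set S := ∑ i, ‖⟪e, u i⟫_ℂ‖ ^ 2
  set d : ℝ := (Module.finrank ℂ E : ℝ)
  set n : ℝ := (Fintype.card ι : ℝ)
  have key : ∀ r : ℝ, 0 < r → r < 1 → r ^ 2 * (d * S) ≤ n := by
    intro r hr0 hr1
    have hr2 : 0 < 1 - r ^ 2 := by nlinarith
    set T : E →L[ℂ] E := 1 + (innerSL ℂ e).smulRight (((r - 1 : ℝ) : ℂ) • e) with hT
    have hTapp : ∀ x, T x = x + (((r - 1 : ℝ) : ℂ) * ⟪e, x⟫_ℂ) • e := by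
      intro x
      simp [hT, smul_smul, mul_comm]
    have hTdet : T.det = (r : ℂ) := by
      have : (T : E →ₗ[ℂ] E) =
          LinearMap.transvection (innerSL ℂ e : E →ₗ[ℂ] ℂ) (((r - 1 : ℝ) : ℂ) • e) := by
        ext x
        simp [hT, LinearMap.transvection.apply]
      rw [ContinuousLinearMap.det, this, LinearMap.transvection.det]
      simp [inner_self_eq_norm_sq_to_K, he]
    have hTnorm : ∀ x, ‖T x‖ ^ 2 = ‖x‖ ^ 2 - (1 - r ^ 2) * ‖⟪e, x⟫_ℂ‖ ^ 2 := by
      intro x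
      rw [hTapp, @norm_add_sq ℂ, inner_smul_right, norm_smul, he, norm_mul, Complex.norm_real,
        ← inner_conj_symm x e, mul_assoc, Complex.mul_conj, Complex.normSq_eq_norm_sq]
      rw [← Complex.ofReal_mul]
      simp only [RCLike.re_to_complex, Complex.ofReal_re, mul_one, mul_pow, Real.norm_eq_abs,
        sq_abs]
      ring
    have hTA : (T.comp A).det = r * A.det := by
      rw [← hTdet]
      exact LinearMap.det_comp _ _
    have hTA0 : (T.comp A).det ≠ 0 := by
      rw [hTA]
      exact mul_ne_zero (by exact_mod_cast hr0.ne') hA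
    have hlog : ∀ i, Real.log ‖T (A (v i))‖ ≤
        Real.log ‖A (v i)‖ - (1 - r ^ 2) / 2 * ‖⟪e, u i⟫_ℂ‖ ^ 2 := by
      intro i
      have h0 : ‖T (u i)‖ ≠ 0 := by
        intro h0
        have hTAi := ContinuousLinearMap.apply_ne_zero_of_det_ne_zero hTA0 (h.ne_zero i)
        rw [norm_eq_zero, hu] at h0
        simp only [map_smul, smul_eq_zero] at h0
        rcases h0 with h0 | h0
        · exact hAv i (by simpa using h0)
        · exact hTAi h0
      have h1 : ‖T (A (v i))‖ = ‖A (v i)‖ * ‖T (u i)‖ := by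
        rw [hu, map_smul, norm_smul]
        simp [hAv i]
      have h2 := Real.log_le_sub_one_of_pos (show 0 < ‖T (u i)‖ ^ 2 by positivity)
      rw [Real.log_pow, hTnorm, hu1] at h2
      rw [h1, Real.log_mul (hAv i) h0]
      push_cast at h2
      linarith
    have hm := hmax _ hTA0
    simp only [radialPotential, hTA, norm_mul, Complex.norm_real, Real.norm_eq_abs,
      abs_of_pos hr0] at hm
    rw [Real.log_mul hr0.ne' (norm_ne_zero_iff.2 hA)] at hm
    have hs : ∑ i, Real.log ‖T (A (v i))‖ ≤
        ∑ i, Real.log ‖A (v i)‖ - (1 - r ^ 2) / 2 * S := by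
      rw [Finset.mul_sum, ← Finset.sum_sub_distrib]
      exact Finset.sum_le_sum fun i _ => hlog i
    have hd0 : 0 ≤ d := Nat.cast_nonneg _
    have hn0 : 0 ≤ n := Nat.cast_nonneg _
    have hs' := mul_le_mul_of_nonneg_left hs hd0
    have hlogr := Real.log_le_sub_one_of_pos (show 0 < (r ^ 2)⁻¹ by positivity)
    rw [Real.log_inv, Real.log_pow] at hlogr
    push_cast at hlogr
    have hlogr' := mul_le_mul_of_nonneg_left hlogr hn0
    simp only [ContinuousLinearMap.comp_apply] at hm
    have h3 : (1 - r ^ 2) * (d * S) ≤ n * ((r ^ 2)⁻¹ - 1) := by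
      simp only [d, n] at *
      linarith
    have h4 := mul_le_mul_of_nonneg_left h3 (sq_nonneg r)
    have h5 : r ^ 2 * (n * ((r ^ 2)⁻¹ - 1)) = (1 - r ^ 2) * n := by
      field_simp
    rw [h5] at h4
    refine le_of_mul_le_mul_left ?_ hr2
    linarith
  have hlim : Filter.Tendsto (fun r : ℝ => r ^ 2 * (d * S)) (nhdsWithin 1 (Set.Iio 1))
      (nhds (1 ^ 2 * (d * S))) := by
    refine Filter.Tendsto.mono_left ?_ nhdsWithin_le_nhds
    exact ((continuous_pow 2).mul continuous_const).tendsto 1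
  rw [one_pow, one_mul] at hlim
  refine le_of_tendsto hlim ?_
  filter_upwards [Ioo_mem_nhdsLT (show (0 : ℝ) < 1 from one_pos)] with r hr
  exact key r hr.1 hr.2

end IsSylvesterGallai

/-- Unit vectors in a space of dimension at most `d` cannot be too close to pairwise orthogonal. -/
theorem sq_card_le_mul_sum_norm_inner_sq [FiniteDimensional ℂ E] {d : ℕ}
    (hd : Module.finrank ℂ E ≤ d) (s : Finset ι) (u : ι → E) (hu : ∀ i ∈ s, ‖u i‖ = 1) :
    (s.card : ℝ) ^ 2 ≤ d * ∑ i ∈ s, ∑ j ∈ s, ‖⟪u i, u j⟫_ℂ‖ ^ 2 := by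
  set b := stdOrthonormalBasis ℂ E
  set M : Fin (Module.finrank ℂ E) → Fin (Module.finrank ℂ E) → ℂ :=
    fun k l => ∑ i ∈ s, ⟪u i, b k⟫_ℂ * ⟪b l, u i⟫_ℂ with hM
  have hsum : ∑ i ∈ s, ∑ j ∈ s, ‖⟪u i, u j⟫_ℂ‖ ^ 2 = ∑ k, ∑ l, ‖M k l‖ ^ 2 := by
    apply Complex.ofReal_injective
    push_cast
    have h1 : ∀ i j, (‖⟪u i, u j⟫_ℂ‖ : ℂ) ^ 2 =
        ∑ k, ∑ l, (⟪u i, b k⟫_ℂ * ⟪b l, u i⟫_ℂ) * (⟪b k, u j⟫_ℂ * ⟪u j, b l⟫_ℂ) := by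
      intro i j
      rw [← Complex.mul_conj', inner_conj_symm, ← b.sum_inner_mul_inner (u i) (u j),
        ← b.sum_inner_mul_inner (u j) (u i), Finset.sum_mul_sum]
      refine Finset.sum_congr rfl fun k _ => Finset.sum_congr rfl fun l _ => ?_
      ring
    have h2 : ∀ k l, (‖M k l‖ : ℂ) ^ 2 =
        ∑ i ∈ s, ∑ j ∈ s, (⟪u i, b k⟫_ℂ * ⟪b l, u i⟫_ℂ) * (⟪b k, u j⟫_ℂ * ⟪u j, b l⟫_ℂ) := by
      intro k l
      rw [← Complex.mul_conj', hM, map_sum, Finset.sum_mul_sum]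
      refine Finset.sum_congr rfl fun i _ => Finset.sum_congr rfl fun j _ => ?_
      rw [map_mul, inner_conj_symm, inner_conj_symm]
    simp only [h1, h2]
    calc _ = ∑ i ∈ s, ∑ k, ∑ j ∈ s, ∑ l, _ :=
          Finset.sum_congr rfl fun i _ => Finset.sum_comm
      _ = ∑ i ∈ s, ∑ k, ∑ l, ∑ j ∈ s, _ :=
          Finset.sum_congr rfl fun i _ => Finset.sum_congr rfl fun k _ => Finset.sum_comm
      _ = ∑ k, ∑ i ∈ s, ∑ l, ∑ j ∈ s, _ := Finset.sum_comm
      _ = _ := Finset.sum_congr rfl fun k _ => Finset.sum_comm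
  have htrace : ∑ k, M k k = s.card := by
    simp only [hM]
    rw [Finset.sum_comm]
    rw [Finset.cast_card]
    refine Finset.sum_congr rfl fun i hi => ?_
    rw [b.sum_inner_mul_inner, inner_self_eq_norm_sq_to_K, hu i hi]
    simp
  have h3 : (s.card : ℝ) ≤ ∑ k, ‖M k k‖ := by
    have := norm_sum_le Finset.univ fun k => M k k
    rw [htrace, Complex.norm_natCast] at this
    exact this
  have h4 : (∑ k, ‖M k k‖) ^ 2 ≤ Module.finrank ℂ E * ∑ k, ‖M k k‖ ^ 2 := by
    simpa using sq_sum_le_card_mul_sum_sq (s := Finset.univ) (f := fun k => ‖M k k‖)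
  have h5 : ∑ k, ‖M k k‖ ^ 2 ≤ ∑ k, ∑ l, ‖M k l‖ ^ 2 :=
    Finset.sum_le_sum fun k _ =>
      Finset.single_le_sum (f := fun l => ‖M k l‖ ^ 2) (fun _ _ => sq_nonneg _) (Finset.mem_univ k)
  rw [hsum]
  calc (s.card : ℝ) ^ 2 ≤ (∑ k, ‖M k k‖) ^ 2 := by gcongr
    _ ≤ Module.finrank ℂ E * ∑ k, ‖M k k‖ ^ 2 := h4
    _ ≤ d * ∑ k, ∑ l, ‖M k l‖ ^ 2 := by gcongr

namespace IsSylvesterGallai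

open Classical in
theorem sum_norm_inner_sq_ge [Fintype ι] (h : IsSylvesterGallai v) (hv : ∀ i, ‖v i‖ = 1) :
    ((Finset.univ : Finset ι).offDiag.card : ℝ) ≤
      4 * ∑ p ∈ (Finset.univ : Finset ι).offDiag, ‖⟪v p.1, v p.2⟫_ℂ‖ ^ 2 := by
  set L : ι × ι → Finset ι := fun p =>
    Finset.univ.filter fun k => v k ∈ Submodule.span ℂ {v p.1, v p.2} with hL
  have hmemL : ∀ p k, k ∈ L p ↔ v k ∈ Submodule.span ℂ {v p.1, v p.2} := by simp [hL]
  have hle : ∀ p q : ι × ι, q ∈ (L p).offDiag → L q = L p := by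
    rintro ⟨i, j⟩ ⟨k, l⟩ hq
    simp only [Finset.mem_offDiag, hmemL] at hq
    obtain ⟨hk, hl, hkl⟩ := hq
    have hspan : Submodule.span ℂ {v k, v l} = Submodule.span ℂ {v i, v j} := by
      have hli : LinearIndependent ℂ ![v k, v l] := by
        rw [LinearIndependent.pair_iff' (h.ne_zero k)]
        exact fun a ha => h.not_proportional l k hkl.symm a ha.symm
      have hrank := finrank_span_eq_card hli
      rw [Matrix.range_cons_cons_empty, Fintype.card_fin] at hrank
      have hle : Submodule.span ℂ {v k, v l} ≤ Submodule.span ℂ {v i, v j} := by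
        rw [Submodule.span_le]
        rintro x (rfl | rfl)
        exacts [hk, hl]
      have : FiniteDimensional ℂ (Submodule.span ℂ {v i, v j}) :=
        FiniteDimensional.span_of_finite ℂ (by simp)
      refine Submodule.eq_of_le_of_finrank_le hle ?_
      rw [hrank]
      have := finrank_span_le_card (R := ℂ) ({v i, v j} : Set E)
      refine this.trans ?_
      simpa using Finset.card_le_two (a := v i) (b := v j)
    ext m
    simp only [hmemL, hspan]
  have hself : ∀ p : ι × ι, p.1 ∈ L p ∧ p.2 ∈ L p := fun p =>
    ⟨(hmemL _ _).2 (Submodule.subset_span (by simp)),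
      (hmemL _ _).2 (Submodule.subset_span (by simp))⟩
  set lines := (Finset.univ : Finset ι).offDiag.image L with hlines
  have hmaps : ∀ p ∈ (Finset.univ : Finset ι).offDiag, L p ∈ lines := fun p hp =>
    Finset.mem_image_of_mem _ hp
  have hfiber : ∀ ℓ ∈ lines, ((Finset.univ : Finset ι).offDiag.filter fun p => L p = ℓ) =
      ℓ.offDiag := by
    intro ℓ hℓ
    obtain ⟨p, hp, rfl⟩ := Finset.mem_image.1 hℓ
    ext q
    simp only [Finset.mem_filter, Finset.mem_offDiag, Finset.mem_univ, true_and]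
    constructor
    · rintro ⟨hq, hqp⟩
      rw [← hqp]
      exact ⟨(hself q).1, (hself q).2, hq⟩
    · intro hq
      exact ⟨hq.2.2, hle p q (by simpa using hq)⟩
  have hline : ∀ ℓ ∈ lines, (ℓ.offDiag.card : ℝ) ≤
      4 * ∑ p ∈ ℓ.offDiag, ‖⟪v p.1, v p.2⟫_ℂ‖ ^ 2 := by
    intro ℓ hℓ
    obtain ⟨⟨i, j⟩, hp, rfl⟩ := Finset.mem_image.1 hℓ
    have hij : i ≠ j := by simpa using hp
    have hcard : 3 ≤ (L (i, j)).card := by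
      obtain ⟨k, hki, hkj, a, b, hk⟩ := h.exists_third i j hij
      have hsub : ({i, j, k} : Finset ι) ⊆ L (i, j) := by
        intro m hm
        simp only [Finset.mem_insert, Finset.mem_singleton] at hm
        rcases hm with rfl | rfl | rfl
        · exact (hself (m, j)).1
        · exact (hself (i, m)).2
        · rw [hmemL, hk]
          exact Submodule.mem_span_pair.2 ⟨a, b, rfl⟩
      have := Finset.card_le_card hsub
      rwa [Finset.card_eq_three.2 ⟨i, j, k, hij, hki.symm, hkj.symm, rfl⟩] at this
    set W := Submodule.span ℂ {v i, v j} with hW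
    have : FiniteDimensional ℂ W := FiniteDimensional.span_of_finite ℂ (by simp)
    have hWrank : Module.finrank ℂ W ≤ 2 := by
      refine (finrank_span_le_card (R := ℂ) ({v i, v j} : Set E)).trans ?_
      simpa using Finset.card_le_two (a := v i) (b := v j)
    set u : ι → W := fun k => if hk : v k ∈ W then ⟨v k, hk⟩ else 0 with hu
    have hu' : ∀ k ∈ L (i, j), (u k : E) = v k := by
      intro k hk
      exact congrArg Subtype.val (dif_pos ((hmemL _ _).1 hk))
    have hplane := sq_card_le_mul_sum_norm_inner_sq hWrank (L (i, j)) u fun k hk => by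
      rw [← hv k, ← hu' k hk]; rfl
    have hsq : ∑ k ∈ L (i, j), ∑ l ∈ L (i, j), ‖⟪u k, u l⟫_ℂ‖ ^ 2 =
        (L (i, j)).card + ∑ p ∈ (L (i, j)).offDiag, ‖⟪v p.1, v p.2⟫_ℂ‖ ^ 2 := by
      have h1 : ∑ k ∈ L (i, j), ∑ l ∈ L (i, j), ‖⟪u k, u l⟫_ℂ‖ ^ 2 =
          ∑ p ∈ L (i, j) ×ˢ L (i, j), ‖⟪v p.1, v p.2⟫_ℂ‖ ^ 2 := by
        rw [Finset.sum_product]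
        refine Finset.sum_congr rfl fun k hk => Finset.sum_congr rfl fun l hl => ?_
        rw [Submodule.coe_inner, hu' k hk, hu' l hl]
      rw [h1, ← Finset.diag_union_offDiag, Finset.sum_union (Finset.disjoint_diag_offDiag _),
        Finset.sum_diag, Finset.cast_card]
      congr 1
      refine Finset.sum_congr rfl fun k _ => ?_
      rw [inner_self_eq_norm_sq_to_K, hv]
      simp
    rw [hsq] at hplane
    rw [Finset.offDiag_card]
    have h3 : (3 : ℝ) ≤ (L (i, j)).card := by exact_mod_cast hcard
    rw [Nat.cast_sub (Nat.le_mul_self _)]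
    push_cast at hplane ⊢
    nlinarith
  rw [← Finset.sum_fiberwise_of_maps_to hmaps, Finset.card_eq_sum_card_fiberwise hmaps,
    Finset.mul_sum]
  push_cast
  refine Finset.sum_le_sum fun ℓ hℓ => ?_
  rw [hfiber ℓ hℓ]
  exact hline ℓ hℓ

/-- **Kelly's theorem**: a spanning Sylvester-Gallai family lives in dimension at most `3`. -/
theorem finrank_le_three_of_span_eq_top [Fintype ι] [FiniteDimensional ℂ E]
    (h : IsSylvesterGallai v) (hspan : Submodule.span ℂ (Set.range v) = ⊤) :
    Module.finrank ℂ E ≤ 3 := by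
  classical
  rcases subsingleton_or_nontrivial E with hE | hE
  · rw [Module.finrank_zero_of_subsingleton]
    omega
  have hι : Nonempty ι := by
    by_contra hι
    rw [not_nonempty_iff] at hι
    rw [Set.range_eq_empty, Submodule.span_empty] at hspan
    exact bot_ne_top hspan
  obtain ⟨u, hSG, hu, hiso⟩ := h.exists_isotropic hspan
  have hlow := hSG.sum_norm_inner_sq_ge hu
  have hup : ∑ i, (Module.finrank ℂ E * ∑ j, ‖⟪u i, u j⟫_ℂ‖ ^ 2) ≤
      ∑ _i : ι, (Fintype.card ι : ℝ) := Finset.sum_le_sum fun i _ => hiso (u i) (hu i)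
  rw [← Finset.mul_sum, ← Finset.sum_product', ← Finset.diag_union_offDiag,
    Finset.sum_union (Finset.disjoint_diag_offDiag _), Finset.sum_diag] at hup
  have hdiag : ∑ i, ‖⟪u i, u i⟫_ℂ‖ ^ 2 = (Fintype.card ι : ℝ) := by
    rw [← Finset.card_univ, Finset.cast_card]
    refine Finset.sum_congr rfl fun k _ => ?_
    rw [inner_self_eq_norm_sq_to_K, hu]
    simp
  rw [hdiag, Finset.sum_const, Finset.card_univ, nsmul_eq_mul] at hup
  rw [Finset.offDiag_card, Nat.cast_sub (Nat.le_mul_self _), Finset.card_univ] at hlow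
  push_cast at hlow
  have hn : (1 : ℝ) ≤ Fintype.card ι := by exact_mod_cast Fintype.card_pos
  by_contra hd
  have hd4 : (4 : ℝ) ≤ Module.finrank ℂ E := by exact_mod_cast not_le.1 hd
  set n : ℝ := (Fintype.card ι : ℝ)
  set S := ∑ p ∈ (Finset.univ : Finset ι).offDiag, ‖⟪u p.1, u p.2⟫_ℂ‖ ^ 2
  have hS : 0 ≤ S := Finset.sum_nonneg fun _ _ => sq_nonneg _
  nlinarith [mul_le_mul_of_nonneg_right hd4 (show 0 ≤ n + S by linarith)]

end IsSylvesterGallai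

end Kelly

theorem IsSylvesterGallai.finrank_span_le_three {ι E : Type*} [Finite ι] [AddCommGroup E]
    [Module ℂ E] {v : ι → E} (h : IsSylvesterGallai v) :
    Module.finrank ℂ (Submodule.span ℂ (Set.range v)) ≤ 3 := by
  have := Fintype.ofFinite ι
  set W := Submodule.span ℂ (Set.range v) with hW
  have : FiniteDimensional ℂ W := FiniteDimensional.span_of_finite ℂ (Set.finite_range v)
  set u : ι → W := fun i => ⟨v i, Submodule.subset_span ⟨i, rfl⟩⟩ with hu
  have hSG : IsSylvesterGallai u :=
    { ne_zero := fun i hi => h.ne_zero i (congrArg Subtype.val hi)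
      not_proportional := fun i j hij c hc => h.not_proportional i j hij c (congrArg Subtype.val hc)
      exists_third := fun i j hij => by
        obtain ⟨k, hki, hkj, a, b, hk⟩ := h.exists_third i j hij
        exact ⟨k, hki, hkj, a, b, Subtype.ext hk⟩ }
  have hspan : Submodule.span ℂ (Set.range u) = ⊤ := by
    apply Submodule.map_injective_of_injective W.injective_subtype
    rw [Submodule.map_span, ← Set.range_comp, Submodule.map_top, Submodule.range_subtype]
    rfl
  set e : W ≃ₗ[ℂ] EuclideanSpace ℂ (Fin (Module.finrank ℂ W)) :=
    (Module.finBasis ℂ W).equivFun.trans (WithLp.linearEquiv 2 ℂ _).symm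
  have := (hSG.map e.toLinearMap e.injective).finrank_le_three_of_span_eq_top (by
    rw [Set.range_comp, ← Submodule.map_span, hspan, Submodule.map_top]
    exact LinearEquiv.range e)
  rwa [finrank_euclideanSpace_fin] at this

/-- Version of `IsSylvesterGallai.finrank_span_le_three` for a family of nonzero vectors in which
proportional members are allowed. -/
theorem finrank_span_range_le_three {ι E : Type*} [Finite ι] [AddCommGroup E] [Module ℂ E]
    {w : ι → E} (hw : ∀ i, w i ≠ 0)
    (h : ∀ i j, (∀ c : ℂ, w j ≠ c • w i) →
      ∃ k, ∃ a b : ℂ, a ≠ 0 ∧ b ≠ 0 ∧ w k = a • w i + b • w j) :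
    Module.finrank ℂ (Submodule.span ℂ (Set.range w)) ≤ 3 := by
  classical
  let L : Set (Submodule ℂ E) := Set.range fun i => Submodule.span ℂ {w i}
  have hL : ∀ l : L, ∃ i, Submodule.span ℂ {w i} = l.1 := fun l => l.2
  choose r hr using hL
  let c : ι → L := fun i => ⟨_, i, rfl⟩
  have hc : ∀ i, ∃ t : ℂ, t ≠ 0 ∧ w i = t • w (r (c i)) := by
    intro i
    have h1 : w i ∈ Submodule.span ℂ {w (r (c i))} := by
      rw [hr (c i)]; exact Submodule.mem_span_singleton_self _
    obtain ⟨t, ht⟩ := Submodule.mem_span_singleton.1 h1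
    refine ⟨t, ?_, ht.symm⟩
    rintro rfl
    exact hw i (by simp [← ht])
  have hne : ∀ i j : L, i ≠ j → ∀ t : ℂ, w (r i) ≠ t • w (r j) := by
    intro i j hij t ht
    apply hij
    apply Subtype.ext
    rw [← hr i, ← hr j, ht]
    refine Submodule.span_singleton_smul_eq (IsUnit.mk0 t ?_) _
    rintro rfl
    exact hw (r i) (by simp [ht])
  have hrc : ∀ l : L, c (r l) = l := fun l => Subtype.ext (hr l)
  have hSG : IsSylvesterGallai fun l : L => w (r l) := by
    refine ⟨fun l => hw _, hne, fun i j hij => ?_⟩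
    obtain ⟨k, a, b, ha, hb, hk⟩ := h (r i) (r j) (hne j i hij.symm)
    obtain ⟨t, ht, htk⟩ := hc k
    have key : w (r (c k)) = (t⁻¹ * a) • w (r i) + (t⁻¹ * b) • w (r j) := by
      rw [mul_smul, mul_smul, ← smul_add, ← hk]
      exact (inv_smul_eq_iff₀ ht).2 htk |>.symm
    refine ⟨c k, ?_, ?_, _, _, key⟩
    · intro hki
      refine hne j i hij.symm (b⁻¹ * (t - a)) ?_
      rw [hki] at htk
      rw [mul_smul, sub_smul, ← htk, hk, add_sub_cancel_left, inv_smul_smul₀ hb]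
    · intro hkj
      refine hne i j hij (a⁻¹ * (t - b)) ?_
      rw [hkj] at htk
      rw [mul_smul, sub_smul, ← htk, hk, add_sub_cancel_right, inv_smul_smul₀ ha]
  have hspan : Submodule.span ℂ (Set.range w) ≤
      Submodule.span ℂ (Set.range fun l : L => w (r l)) := by
    rw [Submodule.span_le]
    rintro _ ⟨i, rfl⟩
    obtain ⟨t, -, ht⟩ := hc i
    rw [SetLike.mem_coe, ht]
    exact Submodule.smul_mem _ _ (Submodule.subset_span ⟨c i, rfl⟩)
  have : Module.Finite ℂ (Submodule.span ℂ (Set.range fun l : L => w (r l))) :=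
    Module.Finite.span_of_finite ℂ (Set.finite_range _)
  exact (Submodule.finrank_mono hspan).trans hSG.finrank_span_le_three

namespace MvPolynomial

variable {n : ℕ}

/-- The linear form attached to a linear functional on `ℂⁿ`. -/
noncomputable def ofDual (f : Module.Dual ℂ (Fin n → ℂ)) : MvPolynomial (Fin n) ℂ :=
  ∑ i, f (Pi.single i 1) • X i

theorem eval_ofDual (f : Module.Dual ℂ (Fin n → ℂ)) (p : Fin n → ℂ) :
    eval p (ofDual f) = f p := by
  conv_rhs => rw [pi_eq_sum_univ' p]
  simp only [ofDual, map_sum, map_smul, smul_eval, eval_X, smul_eq_mul]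
  refine Finset.sum_congr rfl fun i _ => ?_
  rw [mul_comm]

theorem isHomogeneous_ofDual (f : Module.Dual ℂ (Fin n → ℂ)) : (ofDual f).IsHomogeneous 1 :=
  (homogeneousSubmodule (Fin n) ℂ 1).sum_mem fun i _ =>
    (homogeneousSubmodule (Fin n) ℂ 1).smul_mem _ (isHomogeneous_X ℂ i)

theorem IsHomogeneous.exists_eq_ofDual {c : MvPolynomial (Fin n) ℂ} (hc : c.IsHomogeneous 1) :
    ∃ f : Module.Dual ℂ (Fin n → ℂ), c = ofDual f := by
  rw [← mem_homogeneousSubmodule, homogeneousSubmodule_one_eq_span_X] at hc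
  induction hc using Submodule.span_induction with
  | mem x hx =>
    obtain ⟨i, rfl⟩ := hx
    exact ⟨LinearMap.proj i, MvPolynomial.funext fun p => by simp [eval_ofDual]⟩
  | zero => exact ⟨0, MvPolynomial.funext fun p => by simp [eval_ofDual]⟩
  | add x y _ _ hx hy =>
    obtain ⟨f, rfl⟩ := hx
    obtain ⟨g, rfl⟩ := hy
    exact ⟨f + g, MvPolynomial.funext fun p => by simp [eval_ofDual]⟩
  | smul a x _ hx =>
    obtain ⟨f, rfl⟩ := hx
    exact ⟨a • f, MvPolynomial.funext fun p => by simp [eval_ofDual]⟩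

/-- The polar form of a homogeneous quadratic. -/
theorem IsHomogeneous.exists_polar {Q : MvPolynomial (Fin n) ℂ} (hQ : Q.IsHomogeneous 2) :
    ∃ B : (Fin n → ℂ) →ₗ[ℂ] (Fin n → ℂ) →ₗ[ℂ] ℂ, (∀ p y, B p y = B y p) ∧
      (∀ p, B p p = 2 * eval p Q) ∧
      ∀ p y, eval (p + y) Q = eval p Q + eval y Q + B p y := by
  rw [← mem_homogeneousSubmodule, ← homogeneousSubmodule_one_pow, pow_two] at hQ
  induction hQ using Submodule.mul_induction_on' with
  | mem_mul_mem a ha b hb =>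
    obtain ⟨f, rfl⟩ := IsHomogeneous.exists_eq_ofDual ha
    obtain ⟨g, rfl⟩ := IsHomogeneous.exists_eq_ofDual hb
    refine ⟨f.smulRight g + g.smulRight f, fun p y => ?_, fun p => ?_, fun p y => ?_⟩ <;>
      simp [eval_ofDual] <;> ring
  | add x _ y _ hx hy =>
    obtain ⟨B, h1, h2, h3⟩ := hx
    obtain ⟨B', h1', h2', h3'⟩ := hy
    refine ⟨B + B', fun p y => ?_, fun p => ?_, fun p y => ?_⟩
    · simp [h1 p, h1' p]
    · simp [h2, h2', mul_add]
    · simp only [map_add, h3, h3', LinearMap.add_apply]; ring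

end MvPolynomial

theorem exists_combination_of_common_zeros {K : Type*} [AddCommGroup K] [Module ℂ K]
    {f g h : Module.Dual ℂ K} (hf : f ≠ 0) (hfg : ∀ c : ℂ, g ≠ c • f) {α β γ : ℂ}
    (H : ∀ y, α + f y = 0 → β + g y = 0 → γ + h y = 0) :
    ∃ a b : ℂ, h = a • f + b • g ∧ γ = a * α + b * β := by
  have hind : LinearIndependent ℂ ![f, g] := by
    rw [LinearIndependent.pair_iff' hf]
    exact fun c hc => hfg c hc.symm
  have hspan : ∀ h' : Module.Dual ℂ K, (∀ y, f y = 0 → g y = 0 → h' y = 0) →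
      ∃ a b : ℂ, a • f + b • g = h' := by
    intro h' hh'
    have := mem_span_of_iInf_ker_le_ker (L := ![f, g]) (K := h') (by
      intro y hy
      simp only [Submodule.mem_iInf, Fin.forall_fin_two, LinearMap.mem_ker] at hy
      exact hh' y hy.1 hy.2)
    rw [Matrix.range_cons, Matrix.range_cons, Matrix.range_empty, Set.union_empty,
      Set.singleton_union] at this
    exact Submodule.mem_span_pair.1 this
  obtain ⟨y1, hy1f, hy1g⟩ : ∃ y, f y = 0 ∧ g y = 1 := by
    by_contra! hcon
    have : g ∈ Submodule.span ℂ {f} := by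
      have := mem_span_of_iInf_ker_le_ker (L := ![f]) (K := g) (by
        intro y hy
        simp only [Submodule.mem_iInf, LinearMap.mem_ker] at hy
        by_contra hg
        refine hcon ((g y)⁻¹ • y) ?_ ?_
        · simpa using Or.inr (hy 0)
        · simpa using inv_mul_cancel₀ hg)
      simpa using this
    obtain ⟨c, hc⟩ := Submodule.mem_span_singleton.1 this
    exact hfg c hc.symm
  obtain ⟨y2, hy2f⟩ : ∃ y, f y ≠ 0 := by
    by_contra! hcon
    exact hf (LinearMap.ext hcon)
  let y0 : K := (-α / f y2) • y2 + (-β + α / f y2 * g y2) • y1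
  have hf0 : f y0 = -α := by simp [y0, hy1f, hy2f]
  have hg0 : g y0 = -β := by simp [y0, hy1g]; ring
  have hγ : γ + h y0 = 0 := H y0 (by rw [hf0]; ring) (by rw [hg0]; ring)
  obtain ⟨a, b, hab⟩ := hspan h fun y hyf hyg => by
    have := H (y0 + y) (by rw [map_add, hf0, hyf]; ring) (by rw [map_add, hg0, hyg]; ring)
    rw [map_add] at this
    linear_combination this - hγ
  refine ⟨a, b, hab.symm, ?_⟩
  rw [← hab] at hγ
  simp only [LinearMap.add_apply, LinearMap.smul_apply, smul_eq_mul, hf0, hg0] at hγ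
  linear_combination hγ

namespace MvPolynomial

variable {n : ℕ}

theorem span_eval_ne_zero {F : MvPolynomial (Fin n) ℂ} (hF : F ≠ 0) :
    Submodule.span ℂ {p : Fin n → ℂ | eval p F ≠ 0} = ⊤ := by
  by_contra hne
  obtain ⟨f, hf, hle⟩ := Submodule.exists_le_ker_of_lt_top _ (lt_top_iff_ne_top.2 hne)
  have h0 : F * ofDual f = 0 := funext fun p => by
    rw [map_mul, eval_ofDual, map_zero, mul_eq_zero]
    by_contra! hp
    exact hp.2 (hle (Submodule.subset_span hp.1))
  rcases mul_eq_zero.1 h0 with h | h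
  · exact hF h
  · exact hf (LinearMap.ext fun p => by rw [← eval_ofDual, h, map_zero, LinearMap.zero_apply])

theorem exists_eval_ne_zero_sup_span_eq_top {F : MvPolynomial (Fin n) ℂ} (hF : F ≠ 0)
    (K : Submodule ℂ (Fin n → ℂ)) :
    ∃ g : Fin (n - Module.finrank ℂ K) → (Fin n → ℂ), (∀ s, eval (g s) F ≠ 0) ∧
      K ⊔ Submodule.span ℂ (Set.range g) = ⊤ := by
  let S := K.mkQ '' {p : Fin n → ℂ | eval p F ≠ 0}
  have hS : Submodule.span ℂ S = ⊤ := by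
    rw [Submodule.span_image, span_eval_ne_zero hF, Submodule.map_top, Submodule.range_mkQ]
  obtain ⟨f, hf, hspan, -⟩ := Submodule.exists_fun_fin_finrank_span_eq ℂ S
  have hr : Module.finrank ℂ (Submodule.span ℂ S) = n - Module.finrank ℂ K := by
    rw [hS, finrank_top]
    have := K.finrank_quotient_add_finrank
    rw [Module.finrank_fin_fun] at this
    omega
  choose g hg hgf using hf
  refine ⟨g ∘ Fin.cast hr.symm, fun s => hg _, ?_⟩
  have hrange : Set.range (g ∘ Fin.cast hr.symm) = Set.range g :=
    (finCongr hr.symm).surjective.range_comp g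
  have hfg : Set.range f = K.mkQ '' Set.range g := by
    rw [← Set.range_comp]; exact congrArg _ (_root_.funext fun i => (hgf i).symm)
  rw [hrange, ← K.comap_map_mkQ, ← Submodule.span_image, ← hfg, hspan, hS,
    Submodule.comap_top]

/-- A quadratic invariant under translation by `K` is a quadratic over a space of linear forms of
dimension at most the codimension of `K`. -/
theorem exists_quadratic_over_of_invariant (K : Submodule ℂ (Fin n → ℂ)) :
    ∃ V : Submodule ℂ (MvPolynomial (Fin n) ℂ), V ≤ homogeneousSubmodule (Fin n) ℂ 1 ∧
      Module.finrank ℂ V ≤ n - Module.finrank ℂ K ∧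
      ∀ Q : MvPolynomial (Fin n) ℂ, Q.IsHomogeneous 2 →
        (∀ p, ∀ y ∈ K, eval (p + y) Q = eval p Q) →
        Q ∈ Submodule.span ℂ {x | ∃ v ∈ V, ∃ w ∈ V, x = v * w} := by
  let D : Module.Dual ℂ (Fin n → ℂ) →ₗ[ℂ] MvPolynomial (Fin n) ℂ :=
    { toFun := ofDual
      map_add' := fun f g => funext fun p => by simp [eval_ofDual]
      map_smul' := fun a f => funext fun p => by simp [eval_ofDual] }
  have hD : ∀ f, D f = ofDual f := fun f => rfl
  obtain ⟨W, hW⟩ := K.exists_isCompl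
  let π : (Fin n → ℂ) →ₗ[ℂ] (Fin n → ℂ) := W.projection K hW.symm
  have hπ : ∀ p, p - π p ∈ K := by
    intro p
    rw [← Submodule.ker_projection hW.symm, LinearMap.mem_ker, map_sub, sub_eq_zero]
    exact (Submodule.projection_apply_of_mem_left hW.symm
      (Submodule.projection_apply_mem hW.symm p)).symm
  have hπK : ∀ y ∈ K, π y = 0 := by
    intro y hy
    simp [π, hy]
  refine ⟨K.dualAnnihilator.map D, ?_, ?_, ?_⟩
  · rintro _ ⟨f, -, rfl⟩
    exact isHomogeneous_ofDual f
  · refine (Submodule.finrank_map_le _ _).trans ?_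
    have := Subspace.finrank_add_finrank_dualAnnihilator_eq K
    rw [Module.finrank_fin_fun] at this
    omega
  · intro Q hQ hinv
    let φ : MvPolynomial (Fin n) ℂ →ₐ[ℂ] MvPolynomial (Fin n) ℂ :=
      aeval fun i => ofDual (LinearMap.proj i ∘ₗ π)
    have hφeval : ∀ P p, eval p (φ P) = eval (π p) P := by
      intro P p
      have : (aeval p).comp φ = aeval (π p) := by
        ext i
        simp [φ, eval_ofDual]
      simpa [coe_aeval_eq_eval] using DFunLike.congr_fun this P
    have hφQ : φ Q = Q := funext fun p => by
      rw [hφeval]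
      have := hinv (π p) _ (hπ p)
      rw [← this]
      congr 2
      abel
    have hφ1 : (homogeneousSubmodule (Fin n) ℂ 1).map φ.toLinearMap ≤
        K.dualAnnihilator.map D := by
      rintro _ ⟨c, hc, rfl⟩
      obtain ⟨f, rfl⟩ := IsHomogeneous.exists_eq_ofDual hc
      refine ⟨f ∘ₗ π, ?_, funext fun p => ?_⟩
      · rw [SetLike.mem_coe, Submodule.mem_dualAnnihilator]
        intro y hy
        simp [hπK y hy]
      · rw [hD, AlgHom.toLinearMap_apply, hφeval, eval_ofDual, eval_ofDual]; rfl
    have hspan : Submodule.span ℂ {x | ∃ v ∈ K.dualAnnihilator.map D,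
        ∃ w ∈ K.dualAnnihilator.map D, x = v * w} =
        K.dualAnnihilator.map D * K.dualAnnihilator.map D := by
      rw [Submodule.mul_eq_span_mul_set]
      congr 1
      ext x
      simp [Set.mem_mul, eq_comm]
    rw [hspan, ← hφQ]
    rw [← mem_homogeneousSubmodule, ← homogeneousSubmodule_one_pow, pow_two] at hQ
    refine mul_le_mul' hφ1 hφ1 ?_
    rw [← Submodule.map_mul]
    exact Submodule.mem_map_of_mem hQ

end MvPolynomial

theorem finrank_iSup_le_card_mul {κ E : Type*} [Fintype κ] [AddCommGroup E] [Module ℂ E]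
    [FiniteDimensional ℂ E] {D : κ → Submodule ℂ E} {c : ℕ}
    (hD : ∀ s, Module.finrank ℂ (D s) ≤ c) :
    Module.finrank ℂ (⨆ s, D s : Submodule ℂ E) ≤ Fintype.card κ * c := by
  classical
  have h : ∀ t : Finset κ, Module.finrank ℂ (t.sup D : Submodule ℂ E) ≤ t.card * c := by
    intro t
    induction t using Finset.induction_on with
    | empty => simp
    | insert a t ha ih =>
      rw [Finset.sup_insert, Finset.card_insert_of_notMem ha, add_mul, one_mul, add_comm]
      exact (Submodule.finrank_add_le_finrank_add_finrank _ _).trans (add_le_add (hD a) ih)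
  rw [← Finset.sup_univ_eq_iSup]
  exact h _

namespace MvPolynomial

variable {n : ℕ}

theorem not_dvd_of_linearIndependent {P Q : MvPolynomial (Fin n) ℂ} (hP : P.IsHomogeneous 2)
    (hQ : Q.IsHomogeneous 2) (hPQ : LinearIndependent ℂ ![P, Q]) : ¬ P ∣ Q := by
  have hP0 : P ≠ 0 := hPQ.ne_zero 0
  have hQ0 : Q ≠ 0 := hPQ.ne_zero 1
  rintro ⟨r, hr⟩
  have hr0 : r ≠ 0 := by rintro rfl; exact hQ0 (by simpa using hr)
  have hdeg := totalDegree_mul_of_isDomain hP0 hr0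
  rw [← hr, hP.totalDegree hP0, hQ.totalDegree hQ0] at hdeg
  rw [totalDegree_eq_zero_iff_eq_C.1 (by omega : r.totalDegree = 0)] at hr
  rw [LinearIndependent.pair_iff' hP0] at hPQ
  exact hPQ (coeff 0 r) (by rw [hr, smul_eq_C_mul, mul_comm])

theorem mul_sub_mul_ne_zero {P Q a : MvPolynomial (Fin n) ℂ} (hP : P.IsHomogeneous 2)
    (hQ : Q.IsHomogeneous 2) (hPQ : LinearIndependent ℂ ![P, Q]) (hirr : Irreducible P)
    (ha : a.IsHomogeneous 1) (ha0 : a ≠ 0) (b : MvPolynomial (Fin n) ℂ) : a * Q - P * b ≠ 0 := by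
  intro h
  have hdvd : P ∣ a * Q := ⟨b, sub_eq_zero.1 h⟩
  rcases hirr.prime.dvd_or_dvd hdvd with h | h
  · have := totalDegree_le_of_dvd_of_isDomain h ha0
    rw [hP.totalDegree hirr.ne_zero, ha.totalDegree ha0] at this
    omega
  · exact not_dvd_of_linearIndependent hP hQ hPQ h

/-- A Sylvester-Gallai family of quadratics vanishing on `K` is invariant under translation by a
subspace whose codimension is at most four times that of `K`. -/
theorem exists_invariant_submodule {ι : Type*} [Finite ι] {Q : ι → MvPolynomial (Fin n) ℂ}
    (hhom : ∀ i, (Q i).IsHomogeneous 2) (hne : ∀ i, Q i ≠ 0)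
    (hirr : ∀ i, Irreducible (Q i) ∨
      ∃ ℓ : MvPolynomial (Fin n) ℂ, ℓ.IsHomogeneous 1 ∧ Q i = ℓ ^ 2)
    (hind : ∀ i j, i ≠ j → LinearIndependent ℂ ![Q i, Q j])
    (hSG : ∀ i j, i ≠ j → ∃ k, k ≠ i ∧ k ≠ j ∧
      ∀ a : Fin n → ℂ, eval a (Q i) = 0 → eval a (Q j) = 0 → eval a (Q k) = 0)
    (K : Submodule ℂ (Fin n → ℂ)) (hK : ∀ i, ∀ y ∈ K, eval y (Q i) = 0) :
    ∃ K' : Submodule ℂ (Fin n → ℂ), n ≤ Module.finrank ℂ K' + 4 * (n - Module.finrank ℂ K) ∧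
      ∀ i p, ∀ y ∈ K', eval (p + y) (Q i) = eval p (Q i) := by
  classical
  have := Fintype.ofFinite ι
  choose B hBsymm hBself hB using fun i => (hhom i).exists_polar
  have hBK : ∀ i p, ∀ y ∈ K, eval (p + y) (Q i) = eval p (Q i) + B i p y := by
    intro i p y hy
    rw [hB, hK i y hy, add_zero]
  have hBKK : ∀ i, ∀ p ∈ K, ∀ y ∈ K, B i p y = 0 := by
    intro i p hp y hy
    have := hBK i p y hy
    rw [hK i _ (K.add_mem hp hy), hK i p hp, zero_add] at this
    exact this.symm
  let I : ι → Prop := fun i => ∃ p, ∃ y ∈ K, B i p y ≠ 0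
  have hI_irr : ∀ i, I i → Irreducible (Q i) := by
    rintro i ⟨p, y, hy, hpy⟩
    refine (hirr i).resolve_right ?_
    rintro ⟨ℓ, hℓ, hQ⟩
    obtain ⟨f, rfl⟩ := hℓ.exists_eq_ofDual
    have hfy : f y = 0 := by
      have := hK i y hy
      rwa [hQ, map_pow, eval_ofDual, sq_eq_zero_iff] at this
    apply hpy
    have := hBK i p y hy
    rw [hQ, map_pow, map_pow, eval_ofDual, eval_ofDual, map_add, hfy, add_zero] at this
    exact (left_eq_add.1 this)
  have hy : ∀ i, ∃ y ∈ K, I i → ∃ p, B i p y ≠ 0 := by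
    intro i
    by_cases hi : I i
    · obtain ⟨p, y, hy, hpy⟩ := hi
      exact ⟨y, hy, fun _ => ⟨p, hpy⟩⟩
    · exact ⟨0, K.zero_mem, fun h => absurd h hi⟩
  choose y hyK hy using hy
  let l : ι → ι → MvPolynomial (Fin n) ℂ := fun i j => ofDual ((B j).flip (y i))
  have hl : ∀ i j p, eval p (l i j) = B j p (y i) := fun i j p => by
    rw [eval_ofDual, LinearMap.flip_apply]
  have hl0 : ∀ i, I i → l i i ≠ 0 := by
    intro i hi h0
    obtain ⟨p, hp⟩ := hy i hi
    exact hp (by rw [← hl, h0, map_zero])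
  let G : ι → ι → MvPolynomial (Fin n) ℂ := fun i j => l i i * Q j - Q i * l i j
  let F : MvPolynomial (Fin n) ℂ := (∏ i, if I i then l i i else 1) * (∏ i, Q i) *
    ∏ i, ∏ j, if I i ∧ i ≠ j then G i j else 1
  have hF : F ≠ 0 := by
    refine mul_ne_zero (mul_ne_zero ?_ ?_) ?_
    · refine Finset.prod_ne_zero_iff.2 fun i _ => ?_
      split_ifs with hi
      exacts [hl0 i hi, one_ne_zero]
    · exact Finset.prod_ne_zero_iff.2 fun i _ => hne i
    · refine Finset.prod_ne_zero_iff.2 fun i _ => Finset.prod_ne_zero_iff.2 fun j _ => ?_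
      split_ifs with hi
      · exact mul_sub_mul_ne_zero (hhom i) (hhom j) (hind i j hi.2) (hI_irr i hi.1)
          (isHomogeneous_ofDual _) (hl0 i hi.1) _
      · exact one_ne_zero
  let M : (Fin n → ℂ) → ι → Module.Dual ℂ K := fun p i => (B i p).domRestrict K
  have hM : ∀ p i (z : K), M p i z = B i p z := fun p i z => rfl
  have hgood : ∀ p, eval p F ≠ 0 →
      Module.finrank ℂ (Submodule.span ℂ (Set.range fun i : {i // I i} => M p i)) ≤ 3 := by
    intro p hp
    simp only [F, map_mul, map_prod, mul_ne_zero_iff, Finset.prod_ne_zero_iff, Finset.mem_univ,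
      true_imp_iff] at hp
    obtain ⟨⟨hp1, hp2⟩, hp3⟩ := hp
    have hl' : ∀ i, I i → B i p (y i) ≠ 0 := fun i hi => by
      simpa [hi, hl] using hp1 i
    have hG' : ∀ i j, I i → i ≠ j →
        B i p (y i) * eval p (Q j) ≠ eval p (Q i) * B j p (y i) := fun i j hi hij => by
      have := hp3 i j
      rw [if_pos ⟨hi, hij⟩, map_sub, map_mul, map_mul, hl, hl] at this
      exact sub_ne_zero.1 this
    have hM0 : ∀ i, I i → M p i ≠ 0 := fun i hi h => hl' i hi (by
      rw [← hM p i ⟨y i, hyK i⟩, h, LinearMap.zero_apply])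
    refine finrank_span_range_le_three (fun i => hM0 i i.2) ?_
    rintro ⟨i, hi⟩ ⟨j, hj⟩ hij
    have hne_ij : i ≠ j := by
      rintro rfl
      exact hij 1 (one_smul _ _).symm
    obtain ⟨k, hki, hkj, hk⟩ := hSG i j hne_ij
    obtain ⟨a, b, hab, hγ⟩ := exists_combination_of_common_zeros (hM0 i hi) hij
      (h := M p k) (α := eval p (Q i)) (β := eval p (Q j)) (γ := eval p (Q k)) (by
        intro z hz1 hz2
        rw [hM, ← hBK _ _ _ z.2] at hz1 hz2 ⊢
        exact hk _ hz1 hz2)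
    have habz : ∀ z ∈ K, B k p z = a * B i p z + b * B j p z := fun z hz => by
      simpa [hM] using LinearMap.congr_fun hab ⟨z, hz⟩
    have ha : a ≠ 0 := by
      rintro rfl
      apply hG' j k hj hkj.symm
      rw [hγ, habz _ (hyK j)]
      ring
    have hb : b ≠ 0 := by
      rintro rfl
      apply hG' i k hi hki.symm
      rw [hγ, habz _ (hyK i)]
      ring
    have hkI : I k := by
      by_contra hkI
      have hMk : M p k = 0 := LinearMap.ext fun z => by
        by_contra hz
        exact hkI ⟨p, z, z.2, hz⟩
      refine hij (-(b⁻¹ * a)) ?_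
      change M p j = _ • M p i
      rw [neg_smul, mul_smul, ← smul_neg, eq_inv_smul_iff₀ hb, eq_neg_iff_add_eq_zero, add_comm,
        ← hab, hMk]
    exact ⟨⟨k, hkI⟩, a, b, ha, hb, hab⟩
  obtain ⟨g, hgF, hg⟩ := exists_eval_ne_zero_sup_span_eq_top hF K
  let D : Submodule ℂ (Module.Dual ℂ K) :=
    ⨆ s, Submodule.span ℂ (Set.range fun i : {i // I i} => M (g s) i)
  have hD : Module.finrank ℂ D ≤ (n - Module.finrank ℂ K) * 3 := by
    simpa using finrank_iSup_le_card_mul fun s => hgood _ (hgF s)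
  refine ⟨D.dualCoannihilator.map K.subtype, ?_, ?_⟩
  · have h1 := Subspace.finrank_add_finrank_dualCoannihilator_eq D
    have h2 := Submodule.finrank_le K
    rw [Module.finrank_fin_fun] at h2
    rw [(Submodule.equivSubtypeMap K _).symm.finrank_eq]
    omega
  · rintro i p _ ⟨z, hz, rfl⟩
    have hzK : (K.subtype z) ∈ K := z.2
    rw [hBK i p _ hzK, add_eq_left]
    have hker : K ⊔ Submodule.span ℂ (Set.range g) ≤ LinearMap.ker ((B i).flip (K.subtype z)) := by
      refine sup_le (fun q hq => hBKK i q hq _ hzK) (Submodule.span_le.2 ?_)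
      rintro _ ⟨s, rfl⟩
      by_cases hi : I i
      · rw [SetLike.mem_coe, Submodule.mem_dualCoannihilator] at hz
        exact hz _ (Submodule.mem_iSup_of_mem s (Submodule.subset_span ⟨⟨i, hi⟩, rfl⟩))
      · by_contra hs
        exact hi ⟨g s, _, hzK, hs⟩
    rw [hg] at hker
    exact hker (Submodule.mem_top (x := p))

theorem not_irreducible_of_eval_eq_zero {Q : MvPolynomial (Fin n) ℂ} (hQ : Q.IsHomogeneous 2)
    (f : Module.Dual ℂ (Fin n → ℂ)) (h : ∀ p, f p = 0 → eval p Q = 0) : ¬ Irreducible Q := by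
  intro hirr
  obtain ⟨B, -, hBself, hB⟩ := hQ.exists_polar
  have hunit : ∀ g : Module.Dual ℂ (Fin n → ℂ), ¬ IsUnit (ofDual g) := fun g hg => by
    have := hg.map (eval (0 : Fin n → ℂ))
    rw [eval_ofDual, map_zero] at this
    exact not_isUnit_zero this
  by_cases hf : ∀ v, f v = 0
  · exact hirr.ne_zero (MvPolynomial.funext fun p => by rw [h p (hf p), map_zero])
  · push Not at hf
    obtain ⟨v, hv⟩ := hf
    have hQfg : Q = ofDual f * ofDual ((f v)⁻¹ • (B.flip v - (eval v Q / f v) • f)) := by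
      refine MvPolynomial.funext fun p => ?_
      have h1 := h (p - (f p / f v) • v) (by simp [hv])
      have h2 := hB (p - (f p / f v) • v) ((f p / f v) • v)
      have h3 := hBself ((f p / f v) • v)
      rw [sub_add_cancel, h1] at h2
      simp only [map_sub, map_smul, LinearMap.sub_apply, LinearMap.smul_apply, hBself v,
        smul_eq_mul] at h2 h3
      rw [map_mul, eval_ofDual, eval_ofDual, h2]
      simp only [LinearMap.sub_apply, LinearMap.smul_apply, LinearMap.flip_apply, smul_eq_mul]
      field_simp at h3 ⊢
      linear_combination -h3
    rcases hirr.isUnit_or_isUnit hQfg with hu | hu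
    exacts [hunit _ hu, hunit _ hu]

theorem le_finrank_ker_add_four {Q : MvPolynomial (Fin n) ℂ}
    {B : (Fin n → ℂ) →ₗ[ℂ] (Fin n → ℂ) →ₗ[ℂ] ℂ}
    (hB : ∀ p y, eval (p + y) Q = eval p Q + eval y Q + B p y)
    (f g : Module.Dual ℂ (Fin n → ℂ)) (h : ∀ p, f p = 0 → g p = 0 → eval p Q = 0) :
    n ≤ Module.finrank ℂ (LinearMap.ker B) + 4 := by
  let Z : Submodule ℂ (Fin n → ℂ) := LinearMap.ker (f.prod g)
  have hZ : ∀ z ∈ Z, f z = 0 ∧ g z = 0 := fun z hz => by simpa [Z] using hz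
  have hZn : n ≤ Module.finrank ℂ Z + 2 := by
    have h1 := (f.prod g).finrank_range_add_finrank_ker
    have h2 := Submodule.finrank_le (LinearMap.range (f.prod g))
    rw [Module.finrank_prod, Module.finrank_self] at h2
    rw [Module.finrank_fin_fun] at h1
    change _ + Module.finrank ℂ Z = n at h1
    omega
  have h1 := (B.domRestrict Z).finrank_range_add_finrank_ker
  have h2 : LinearMap.range (B.domRestrict Z) ≤ Z.dualAnnihilator := by
    rintro _ ⟨z, rfl⟩
    rw [Submodule.mem_dualAnnihilator]
    intro w hw
    have hzw := hB z w
    obtain ⟨hz1, hz2⟩ := hZ z z.2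
    obtain ⟨hw1, hw2⟩ := hZ w hw
    rw [h _ (by simp [hz1, hw1]) (by simp [hz2, hw2]), h _ hz1 hz2, h _ hw1 hw2] at hzw
    simpa using hzw.symm
  have h3 := Subspace.finrank_add_finrank_dualAnnihilator_eq Z
  rw [Module.finrank_fin_fun] at h3
  have h4 := (Submodule.finrank_mono h2).trans (Nat.le_sub_of_add_le' h3.le)
  have h5 : (LinearMap.ker (B.domRestrict Z)).map Z.subtype ≤ LinearMap.ker B := by
    rintro _ ⟨z, hz, rfl⟩
    exact hz
  have h6 := Submodule.finrank_mono h5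
  rw [(Submodule.equivSubtypeMap Z _).symm.finrank_eq] at h6
  omega

theorem ker_polar_le {Q : MvPolynomial (Fin n) ℂ} (hQ : Q.IsHomogeneous 2) (hirr : Irreducible Q)
    {B : (Fin n → ℂ) →ₗ[ℂ] (Fin n → ℂ) →ₗ[ℂ] ℂ} (hBself : ∀ p, B p p = 2 * eval p Q)
    (hB : ∀ p y, eval (p + y) Q = eval p Q + eval y Q + B p y)
    (f g : Module.Dual ℂ (Fin n → ℂ)) (h : ∀ p, f p = 0 → g p = 0 → eval p Q = 0) {y : Fin n → ℂ}
    (hy : B y = 0) : f y = 0 ∧ g y = 0 := by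
  by_contra hcon
  have hinv : ∀ p (t : ℂ), eval (p - t • y) Q = eval p Q := by
    intro p t
    have h0 : B (t • y) = 0 := by rw [map_smul, hy, smul_zero]
    have h1 := hB (t • y) (p - t • y)
    have h2 := hBself (t • y)
    rw [h0, LinearMap.zero_apply] at h1 h2
    rw [add_sub_cancel] at h1
    linear_combination -h1 + (1/2) * h2
  refine not_irreducible_of_eval_eq_zero hQ (g y • f - f y • g) (fun p hp => ?_) hirr
  simp only [LinearMap.sub_apply, LinearMap.smul_apply, smul_eq_mul] at hp
  by_cases hfy : f y = 0
  · have hgy : g y ≠ 0 := fun hgy => hcon ⟨hfy, hgy⟩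
    rw [← hinv p (g p / g y)]
    refine h _ ?_ ?_
    · simp only [map_sub, map_smul, smul_eq_mul, hfy, mul_zero, sub_zero]
      simpa [hfy, hgy] using hp
    · simp [hgy]
  · rw [← hinv p (f p / f y)]
    refine h _ (by simp [hfy]) ?_
    simp only [map_sub, map_smul, smul_eq_mul]
    field_simp
    linear_combination -hp

end MvPolynomial

/-- There is an absolute constant `C` such that: in a Sylvester–Gallai configuration of
pairwise linearly independent homogeneous quadratics `Qf 1, …, Qf m` (each irreducible or
a square of a linear form), if `Q0 ∈ 𝒬` is irreducible and `F 1, …, F m' ∈ 𝒬` each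
satisfy, together with `Q0`, that they vanish on the common zero set of two linear forms,
then there is a subspace `V` of linear forms with `dim V ≤ C` such that every `F i` is a
quadratic over `V`. -/
theorem stmt_13 :
    ∃ C : ℕ, ∀ (n m m' : ℕ) (Qf : Fin m → MvPolynomial (Fin n) ℂ),
      (∀ i, (Qf i).IsHomogeneous 2) →
      (∀ i, Irreducible (Qf i) ∨
        ∃ ℓ : MvPolynomial (Fin n) ℂ, ℓ.IsHomogeneous 1 ∧ Qf i = ℓ ^ 2) →
      (∀ i j, i ≠ j → LinearIndependent ℂ ![Qf i, Qf j]) →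
      (∀ i j, i ≠ j → ∃ k, k ≠ i ∧ k ≠ j ∧
        ∀ a : Fin n → ℂ, eval a (Qf i) = 0 → eval a (Qf j) = 0 → eval a (Qf k) = 0) →
      ∀ Q0 : MvPolynomial (Fin n) ℂ, (∃ i0, Q0 = Qf i0) → Irreducible Q0 →
      ∀ F : Fin m' → MvPolynomial (Fin n) ℂ, (∀ i, ∃ j, F i = Qf j) →
      (∀ i, ∃ c1 c2 : MvPolynomial (Fin n) ℂ, c1.IsHomogeneous 1 ∧ c2.IsHomogeneous 1 ∧
        ∀ a : Fin n → ℂ, eval a c1 = 0 → eval a c2 = 0 →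
          eval a Q0 = 0 ∧ eval a (F i) = 0) →
      ∃ V : Submodule ℂ (MvPolynomial (Fin n) ℂ),
        V ≤ homogeneousSubmodule (Fin n) ℂ 1 ∧ Module.finrank ℂ ↥V ≤ C ∧
        ∀ i, F i ∈ Submodule.span ℂ
          {x : MvPolynomial (Fin n) ℂ | ∃ v ∈ V, ∃ w ∈ V, x = v * w} := by
  refine ⟨16, fun n m m' Qf hhom hirr hind hSG Q0 hQ0 hQ0irr F hF hc => ?_⟩
  obtain ⟨i0, rfl⟩ := hQ0
  rcases isEmpty_or_nonempty (Fin m') with hm' | ⟨⟨s0⟩⟩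
  · exact ⟨⊥, bot_le, by simp, fun i => hm'.elim i⟩
  have hne : ∀ i, Qf i ≠ 0 := fun i => by
    by_cases hi : i = i0
    · exact hi ▸ hQ0irr.ne_zero
    · exact (hind i i0 hi).ne_zero 0
  have hc' : ∀ i, ∃ f g : Module.Dual ℂ (Fin n → ℂ), ∀ p, f p = 0 → g p = 0 →
      eval p (Qf i0) = 0 ∧ eval p (F i) = 0 := by
    intro i
    obtain ⟨c1, c2, hc1, hc2, h⟩ := hc i
    obtain ⟨f, rfl⟩ := hc1.exists_eq_ofDual
    obtain ⟨g, rfl⟩ := hc2.exists_eq_ofDual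
    exact ⟨f, g, fun p => by simpa only [eval_ofDual] using h p⟩
  choose f g hfg using hc'
  obtain ⟨B, -, hBself, hB⟩ := (hhom i0).exists_polar
  let K := LinearMap.ker B
  have hKF : ∀ i, ∀ y ∈ K, eval y (F i) = 0 := fun i y hy =>
    have h := ker_polar_le (hhom i0) hQ0irr hBself hB (f i) (g i)
      (fun p h1 h2 => (hfg i p h1 h2).1) hy
    (hfg i y h.1 h.2).2
  have hKn : n ≤ Module.finrank ℂ K + 4 :=
    le_finrank_ker_add_four hB (f s0) (g s0) fun p h1 h2 => (hfg s0 p h1 h2).1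
  obtain ⟨K', hK'n, hK'⟩ := exists_invariant_submodule
    (Q := fun i : {i // ∀ y ∈ K, eval y (Qf i) = 0} => Qf i) (fun i => hhom i) (fun i => hne i)
    (fun i => hirr i) (fun i j hij => hind i j (Subtype.coe_ne_coe.2 hij))
    (fun i j hij => by
      obtain ⟨k, hki, hkj, hk⟩ := hSG i j (Subtype.coe_ne_coe.2 hij)
      exact ⟨⟨k, fun y hy => hk y (i.2 y hy) (j.2 y hy)⟩, Subtype.coe_ne_coe.1 hki,
        Subtype.coe_ne_coe.1 hkj, hk⟩)
    K fun i => i.2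
  obtain ⟨V, hV1, hVn, hV⟩ := exists_quadratic_over_of_invariant K'
  refine ⟨V, hV1, by omega, fun i => ?_⟩
  obtain ⟨j, hj⟩ := hF i
  rw [hj]
  exact hV _ (hhom j) (hK' ⟨j, fun y hy => hj ▸ hKF i y hy⟩)
end

section
/- There is an absolute constant C such that the following holds. Let 𝒬 ∪ ℒ be a finite set of pairwise linearly independent homogeneous quadratic polynomials in ℂ[x_1, …, x_n] such that for every two distinct elements P_1, P_2 of 𝒬 ∪ ℒ there exists a third element of 𝒬 ∪ ℒ vanishing at every common zero of P_1 and P_2. Assume: (1) every element of 𝒬 is irreducible; (2) every element of ℒ is the square of a linear form; (3) there exist a finite set ℐ of quadratic polynomials and a ℂ-subspace V of the space of linear forms such that every element of 𝒬 lies in the ℂ-linear span of the union of ℐ with the quadratics over V, and no nonzero ℂ-linear combination of the elements of ℐ can be written as x·a + y·b + F, where x, a, y, b are linear forms and F is a quadratic over V. Then the ℂ-linear span of the set of linear forms ℓ with ℓ² ∈ ℒ has dimension at most dim V + C. -/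
open MvPolynomial

/-- Rank bound for design matrices: if the weighted rows of `b` have unit norm, its columns have
weighted square norm `c`, and any two columns overlap with total weight at most one, then the
kernel of `b` has dimension at most `card ι / c`. -/
theorem finrank_mul_sq_le_of_doubly_scaled {ι : Type*} [Fintype ι] [DecidableEq ι]
    (U : Submodule ℂ (EuclideanSpace ℂ ι)) (𝓣 : Finset (Finset ι)) (w : Finset ι → ℝ)
    (b : Finset ι → ι → ℂ) (c : ℝ) (hw : ∀ T ∈ 𝓣, 0 ≤ w T)
    (hsupp : ∀ T ∈ 𝓣, ∀ i ∉ T, b T i = 0)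
    (hrow : ∀ T ∈ 𝓣, ∑ i, ‖b T i‖ ^ 2 = 1)
    (hcol : ∀ i, ∑ T ∈ 𝓣, w T * ‖b T i‖ ^ 2 = c)
    (hpair : ∀ i j, i ≠ j → ∑ T ∈ 𝓣 with i ∈ T ∧ j ∈ T, w T ≤ 1)
    (hdep : ∀ u ∈ U, ∀ T ∈ 𝓣, ∑ i, b T i * u i = 0) :
    Module.finrank ℂ U * c ^ 2 ≤ Fintype.card ι * c := by
  set E : ι → ι → ℂ := fun i j =>
    if i = j then 0 else ∑ T ∈ 𝓣, (w T : ℂ) * (starRingEnd ℂ (b T i) * b T j) with hE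
  have hEu : ∀ u ∈ U, ∀ i, ∑ j, E i j * u j = -(c * u i) := by
    intro u hu i
    have h1 : ∀ j, E i j * u j = (∑ T ∈ 𝓣, (w T : ℂ) * (starRingEnd ℂ (b T i) * b T j)) * u j
        - if i = j then (c : ℂ) * u j else 0 := by
      intro j
      by_cases hij : i = j
      · subst hij
        simp only [hE, if_true, zero_mul, ← hcol i]
        rw [eq_comm, sub_eq_zero]
        congr 1
        push_cast
        refine Finset.sum_congr rfl fun T _ => ?_
        rw [← Complex.normSq_eq_conj_mul_self, Complex.normSq_eq_norm_sq]
        push_cast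
        rfl
      · simp [hE, hij]
    simp only [h1, Finset.sum_sub_distrib, Finset.sum_ite_eq, Finset.mem_univ, if_true]
    have h2 : ∑ j, (∑ T ∈ 𝓣, (w T : ℂ) * (starRingEnd ℂ (b T i) * b T j)) * u j = 0 := by
      simp only [Finset.sum_mul]
      rw [Finset.sum_comm]
      refine Finset.sum_eq_zero fun T hT => ?_
      have := hdep u hu T hT
      calc _ = ∑ j, ((w T : ℂ) * starRingEnd ℂ (b T i)) * (b T j * u j) :=
            Finset.sum_congr rfl fun j _ => by ring
        _ = 0 := by rw [← Finset.mul_sum, this, mul_zero]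
    rw [h2]; ring
  have hEsq : ∀ i j, ‖E i j‖ ^ 2 ≤ ∑ T ∈ 𝓣, w T * (‖b T i‖ ^ 2 * ‖b T j‖ ^ 2) := by
    intro i j
    have hnn : ∀ T ∈ 𝓣, 0 ≤ w T * (‖b T i‖ ^ 2 * ‖b T j‖ ^ 2) := fun T hT =>
      mul_nonneg (hw T hT) (by positivity)
    by_cases hij : i = j
    · simpa [hE, hij] using Finset.sum_nonneg (hij ▸ hnn)
    have hfil : ∑ T ∈ 𝓣, w T * (‖b T i‖ * ‖b T j‖) =
        ∑ T ∈ 𝓣 with i ∈ T ∧ j ∈ T, w T * (‖b T i‖ * ‖b T j‖) := by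
      refine (Finset.sum_filter_of_ne fun T hT h => ?_).symm
      by_contra hcon
      rw [not_and_or] at hcon
      rcases hcon with h' | h' <;> simp [hsupp T hT _ h'] at h
    have h1 : ‖E i j‖ ≤ ∑ T ∈ 𝓣 with i ∈ T ∧ j ∈ T, √(w T) * (√(w T) * (‖b T i‖ * ‖b T j‖)) := by
      simp only [hE, hij, if_false]
      refine (norm_sum_le _ _).trans (le_of_eq ?_)
      have : ∑ T ∈ 𝓣, ‖(w T : ℂ) * (starRingEnd ℂ (b T i) * b T j)‖ =
          ∑ T ∈ 𝓣, w T * (‖b T i‖ * ‖b T j‖) := Finset.sum_congr rfl fun T hT => by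
        simp [abs_of_nonneg (hw T hT)]
      rw [this, hfil]
      refine Finset.sum_congr rfl fun T hT => ?_
      rw [← mul_assoc (√(w T)), Real.mul_self_sqrt (hw T (Finset.mem_filter.1 hT).1)]
    calc ‖E i j‖ ^ 2 ≤ (∑ T ∈ 𝓣 with i ∈ T ∧ j ∈ T,
            √(w T) * (√(w T) * (‖b T i‖ * ‖b T j‖))) ^ 2 := by gcongr
      _ ≤ (∑ T ∈ 𝓣 with i ∈ T ∧ j ∈ T, √(w T) ^ 2) * ∑ T ∈ 𝓣 with i ∈ T ∧ j ∈ T,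
            (√(w T) * (‖b T i‖ * ‖b T j‖)) ^ 2 := Finset.sum_mul_sq_le_sq_mul_sq _ _ _
      _ ≤ 1 * ∑ T ∈ 𝓣 with i ∈ T ∧ j ∈ T, (√(w T) * (‖b T i‖ * ‖b T j‖)) ^ 2 := by
          refine mul_le_mul_of_nonneg_right ?_ (Finset.sum_nonneg fun _ _ => sq_nonneg _)
          refine le_trans (le_of_eq ?_) (hpair i j hij)
          exact Finset.sum_congr rfl fun T hT => Real.sq_sqrt (hw T (Finset.mem_filter.1 hT).1)
      _ = ∑ T ∈ 𝓣 with i ∈ T ∧ j ∈ T, w T * (‖b T i‖ ^ 2 * ‖b T j‖ ^ 2) := by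
          rw [one_mul]
          refine Finset.sum_congr rfl fun T hT => ?_
          rw [mul_pow, mul_pow, Real.sq_sqrt (hw T (Finset.mem_filter.1 hT).1)]
      _ ≤ _ := Finset.sum_le_sum_of_subset_of_nonneg (Finset.filter_subset _ _)
          fun T hT _ => hnn T hT
  have hEtot : ∑ i, ∑ j, ‖E i j‖ ^ 2 ≤ Fintype.card ι * c := by
    calc ∑ i, ∑ j, ‖E i j‖ ^ 2
        ≤ ∑ i, ∑ j, ∑ T ∈ 𝓣, w T * (‖b T i‖ ^ 2 * ‖b T j‖ ^ 2) :=
          Finset.sum_le_sum fun i _ => Finset.sum_le_sum fun j _ => hEsq i j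
      _ = ∑ i : ι, c := by
          refine Finset.sum_congr rfl fun i _ => ?_
          rw [Finset.sum_comm, ← hcol i]
          refine Finset.sum_congr rfl fun T hT => ?_
          rw [← Finset.mul_sum, ← Finset.mul_sum, hrow T hT, mul_one]
      _ = _ := by simp
  let e := stdOrthonormalBasis ℂ U
  have hon : Orthonormal ℂ (fun k => (e k : EuclideanSpace ℂ ι)) :=
    e.orthonormal.comp_linearIsometry U.subtypeₗᵢ
  have hbes : ∀ i, ∑ k, c ^ 2 * ‖(e k : EuclideanSpace ℂ ι) i‖ ^ 2 ≤ ∑ j, ‖E i j‖ ^ 2 := by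
    intro i
    have := hon.sum_inner_products_le (WithLp.toLp 2 fun j => starRingEnd ℂ (E i j))
      (s := Finset.univ)
    rw [EuclideanSpace.norm_sq_eq] at this
    simp only [RCLike.norm_conj] at this
    refine le_trans (le_of_eq ?_) this
    refine Finset.sum_congr rfl fun k _ => ?_
    have h1 : inner ℂ (e k : EuclideanSpace ℂ ι) (WithLp.toLp 2 fun j => starRingEnd ℂ (E i j))
        = starRingEnd ℂ (∑ j, E i j * (e k : EuclideanSpace ℂ ι) j) := by
      rw [PiLp.inner_apply, map_sum]
      refine Finset.sum_congr rfl fun j _ => ?_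
      simp [mul_comm]
    rw [h1, RCLike.norm_conj, hEu _ (e k).2, norm_neg, norm_mul, mul_pow]
    simp
  calc Module.finrank ℂ U * c ^ 2
      = ∑ i, ∑ k, c ^ 2 * ‖(e k : EuclideanSpace ℂ ι) i‖ ^ 2 := by
        rw [Finset.sum_comm]
        have : ∀ k, ∑ i, c ^ 2 * ‖(e k : EuclideanSpace ℂ ι) i‖ ^ 2 = c ^ 2 := by
          intro k
          rw [← Finset.mul_sum, ← EuclideanSpace.norm_sq_eq, hon.1 k]; ring
        simp [this]
    _ ≤ ∑ i, ∑ j, ‖E i j‖ ^ 2 := Finset.sum_le_sum fun i _ => hbes i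
    _ ≤ _ := hEtot

/-- Matrix scaling: a weighted system of triples covering all pairs, with equal total weight at
each point, admits column factors equalising the column sums of the row-normalised matrix `p`.
The factors come from a minimiser of a coercive log-sum-exp functional. -/
theorem exists_exp_scaling {ι : Type*} [Fintype ι] [DecidableEq ι] [Nonempty ι]
    (𝓣 : Finset (Finset ι)) (w : Finset ι → ℝ) (p : Finset ι → ι → ℝ) (c : ℝ)
    (hw : ∀ T ∈ 𝓣, 0 < w T) (hcard : ∀ T ∈ 𝓣, T.card = 3)
    (hp : ∀ T ∈ 𝓣, ∀ i ∈ T, 0 < p T i)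
    (hcover : ∀ i j, i ≠ j → ∃ T ∈ 𝓣, i ∈ T ∧ j ∈ T)
    (hmarg : ∀ i, ∑ T ∈ 𝓣 with i ∈ T, w T = 3 * c) :
    ∃ x : ι → ℝ, ∀ i, ∑ T ∈ 𝓣 with i ∈ T,
      w T * (p T i * Real.exp (x i) / ∑ j ∈ T, p T j * Real.exp (x j)) = c := by
  set S : Finset ι → (ι → ℝ) → ℝ := fun T x => ∑ j ∈ T, p T j * Real.exp (x j) with hS
  have hSpos : ∀ T ∈ 𝓣, ∀ x, 0 < S T x := fun T hT x =>
    Finset.sum_pos (fun i hi => mul_pos (hp T hT i hi) (Real.exp_pos _))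
      (Finset.card_pos.1 (by rw [hcard T hT]; norm_num))
  set f : (ι → ℝ) → ℝ := fun x =>
    ∑ T ∈ 𝓣, w T * Real.log (S T x) - c * ∑ i, x i + (∑ i, x i) ^ 2 with hf
  have hfcont : Continuous f := by
    refine ((continuous_finsetSum _ fun T hT => continuous_const.mul ?_).sub (by fun_prop)).add
      (by fun_prop)
    exact Continuous.log (by simp only [hS]; fun_prop) fun x => (hSpos T hT x).ne'
  set K : Finset ι → ℝ := fun T => ∑ i ∈ T, |Real.log (p T i)| with hK
  have hlog : ∀ T ∈ 𝓣, ∀ i ∈ T, ∀ x : ι → ℝ, x i - K T ≤ Real.log (S T x) := by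
    intro T hT i hi x
    have h1 : p T i * Real.exp (x i) ≤ S T x :=
      Finset.single_le_sum (f := fun j => p T j * Real.exp (x j))
        (fun j hj => (mul_pos (hp T hT j hj) (Real.exp_pos _)).le) hi
    have h2 := Real.log_le_log (mul_pos (hp T hT i hi) (Real.exp_pos _)) h1
    rw [Real.log_mul (hp T hT i hi).ne' (Real.exp_pos _).ne', Real.log_exp] at h2
    have h3 : |Real.log (p T i)| ≤ K T :=
      Finset.single_le_sum (f := fun j => |Real.log (p T j)|) (fun j _ => abs_nonneg _) hi
    linarith [neg_abs_le (Real.log (p T i))]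
  have hlog3 : ∀ T ∈ 𝓣, ∀ i ∈ T, ∀ j ∈ T, ∀ x : ι → ℝ,
      (∑ k ∈ T, x k) / 3 + (x i - x j) / 3 - K T ≤ Real.log (S T x) := by
    intro T hT i hi j hj x
    by_cases hij : i = j
    · subst hij
      have : ∑ k ∈ T, (x k - K T) ≤ ∑ k ∈ T, Real.log (S T x) :=
        Finset.sum_le_sum fun k hk => hlog T hT k hk x
      simp only [Finset.sum_sub_distrib, Finset.sum_const, hcard T hT, nsmul_eq_mul] at this
      push_cast at this
      linarith
    · have hj' : j ∈ T.erase i := Finset.mem_erase.2 ⟨Ne.symm hij, hj⟩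
      have h1 := Finset.add_sum_erase T x hi
      have h2 := Finset.add_sum_erase (T.erase i) x hj'
      have hc : ((T.erase i).erase j).card = 1 := by
        rw [Finset.card_erase_of_mem hj', Finset.card_erase_of_mem hi, hcard T hT]
      obtain ⟨k, hk⟩ := Finset.card_eq_one.1 hc
      have hkT : k ∈ T := by
        have : k ∈ (T.erase i).erase j := by rw [hk]; simp
        exact Finset.mem_of_mem_erase (Finset.mem_of_mem_erase this)
      rw [hk, Finset.sum_singleton] at h2
      linarith [hlog T hT i hi x, hlog T hT k hkT x]
  have havg : ∀ x : ι → ℝ, ∑ T ∈ 𝓣, w T * ((∑ k ∈ T, x k) / 3) = c * ∑ i, x i := by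
    intro x
    have h1 : ∀ T ∈ 𝓣, w T * ((∑ k ∈ T, x k) / 3) = ∑ k, if k ∈ T then w T * x k / 3 else 0 := by
      intro T _
      rw [Finset.sum_ite_mem, Finset.univ_inter, Finset.sum_div, Finset.mul_sum]
      exact Finset.sum_congr rfl fun k _ => by ring
    rw [Finset.sum_congr rfl h1, Finset.sum_comm, Finset.mul_sum]
    refine Finset.sum_congr rfl fun k _ => ?_
    rw [← Finset.sum_filter, ← Finset.sum_div, ← Finset.sum_mul, hmarg k]
    ring
  set M : ℝ := f 0 + ∑ T ∈ 𝓣, w T * K T with hM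
  have hbound : ∀ x, f x ≤ f 0 → ∀ T ∈ 𝓣, ∀ i ∈ T, ∀ j ∈ T,
      w T * ((x i - x j) / 3) + (∑ k, x k) ^ 2 ≤ M := by
    intro x hx T hT i hi j hj
    have h1 : ∑ T' ∈ 𝓣, (w T' * ((∑ k ∈ T', x k) / 3) - w T' * K T'
        + if T' = T then w T * ((x i - x j) / 3) else 0) ≤ ∑ T' ∈ 𝓣, w T' * Real.log (S T' x) := by
      refine Finset.sum_le_sum fun T' hT' => ?_
      by_cases h : T' = T
      · subst h
        have := mul_le_mul_of_nonneg_left (hlog3 T' hT' i hi j hj x) (hw T' hT').le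
        simp only [if_true]
        linarith
      · obtain ⟨k, hk⟩ : T'.Nonempty := Finset.card_pos.1 (by rw [hcard T' hT']; norm_num)
        have := mul_le_mul_of_nonneg_left (hlog3 T' hT' k hk k hk x) (hw T' hT').le
        simp only [h, if_false]
        linarith
    rw [Finset.sum_add_distrib, Finset.sum_sub_distrib, havg, Finset.sum_ite_eq', if_pos hT] at h1
    simp only [hf, hM] at hx ⊢
    linarith
  have hdiff : ∀ i j, ∃ D : ℝ, ∀ x, f x ≤ f 0 → x i - x j ≤ D := by
    intro i j
    by_cases hij : i = j
    · exact ⟨0, fun x _ => by simp [hij]⟩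
    obtain ⟨T, hT, hi, hj⟩ := hcover i j hij
    refine ⟨3 * (M / w T), fun x hx => ?_⟩
    have h1 := hbound x hx T hT i hi j hj
    have h2 : (x i - x j) / 3 ≤ M / w T := by
      rw [le_div_iff₀ (hw T hT)]
      nlinarith [sq_nonneg (∑ k, x k)]
    linarith
  have hsum : ∃ D : ℝ, ∀ x, f x ≤ f 0 → |∑ k, x k| ≤ D := by
    by_cases hne : 𝓣.Nonempty
    · obtain ⟨T, hT⟩ := hne
      obtain ⟨k, hk⟩ : T.Nonempty := Finset.card_pos.1 (by rw [hcard T hT]; norm_num)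
      refine ⟨1 + M, fun x hx => ?_⟩
      have h1 := hbound x hx T hT k hk k hk
      simp only [sub_self, zero_div, mul_zero, zero_add] at h1
      nlinarith [sq_nonneg (|∑ k, x k| - 1), sq_abs (∑ k, x k)]
    · rw [Finset.not_nonempty_iff_eq_empty] at hne
      have hc : c = 0 := by
        have := hmarg (Classical.arbitrary ι)
        simp [hne] at this
        exact this
      refine ⟨0, fun x hx => ?_⟩
      simp only [hf, hne, hc] at hx
      simp at hx
      simpa using hx
  choose D hD using hdiff
  obtain ⟨D', hD'⟩ := hsum
  set R : ι → ℝ := fun i => (∑ j, (|D i j| + |D j i|) + D') with hR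
  have hn1 : (1 : ℝ) ≤ Fintype.card ι := by exact_mod_cast Fintype.card_pos
  have hxR : ∀ x, f x ≤ f 0 → ∀ i, |x i| ≤ R i := by
    intro x hx i
    have h1 : |(Fintype.card ι : ℝ) * x i| ≤ R i := by
      have h2 : (Fintype.card ι : ℝ) * x i = ∑ j, (x i - x j) + ∑ j, x j := by
        rw [Finset.sum_sub_distrib]; simp
      rw [h2]
      refine (abs_add_le _ _).trans (add_le_add ?_ (hD' x hx))
      refine (Finset.abs_sum_le_sum_abs _ _).trans (Finset.sum_le_sum fun j _ => ?_)
      rw [abs_le]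
      constructor
      · linarith [hD j i x hx, le_abs_self (D j i), abs_nonneg (D i j)]
      · linarith [hD i j x hx, le_abs_self (D i j), abs_nonneg (D j i)]
    rw [abs_mul, abs_of_pos (by linarith)] at h1
    nlinarith [abs_nonneg (x i)]
  obtain ⟨x, hx⟩ := hfcont.exists_forall_le' 0 (by
    have : (Set.Icc (-R) R)ᶜ ∈ Filter.cocompact (ι → ℝ) := isCompact_Icc.compl_mem_cocompact
    filter_upwards [this] with y hy
    by_contra hcon
    push Not at hcon
    refine hy ⟨fun i => ?_, fun i => ?_⟩
    · exact (abs_le.1 (hxR y hcon.le i)).1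
    · exact (abs_le.1 (hxR y hcon.le i)).2)
  have hderiv : ∀ i, ∑ T ∈ 𝓣 with i ∈ T, w T * (p T i * Real.exp (x i) / S T x)
      - c + 2 * ∑ k, x k = 0 := by
    intro i
    set y : ℝ → ι → ℝ := fun s j => x j + if j = i then s else 0 with hy
    have hy0 : y 0 = x := by ext j; simp [hy]
    have hyd : ∀ j, HasDerivAt (fun s => y s j) (if j = i then 1 else 0) 0 := by
      intro j
      by_cases h : j = i
      · simpa [hy, h] using (hasDerivAt_id (0 : ℝ)).const_add (x i)
      · simpa [hy, h] using hasDerivAt_const (0 : ℝ) (x j)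
    have hmin : IsLocalMin (fun s => f (y s)) 0 := by
      refine Filter.Eventually.of_forall fun s => ?_
      simp only [hy0]
      exact hx _
    have hsumd : HasDerivAt (fun s => ∑ j, y s j) 1 0 := by
      have := HasDerivAt.fun_sum (u := Finset.univ) fun j _ => hyd j
      simpa using this
    have hSd : ∀ T, HasDerivAt (fun s => S T (y s))
        (if i ∈ T then p T i * Real.exp (x i) else 0) 0 := by
      intro T
      have := HasDerivAt.fun_sum (u := T) fun j _ => ((hyd j).exp).const_mul (p T j)
      refine this.congr_deriv ?_
      rw [← Finset.sum_ite_eq' T i (fun j => p T j * Real.exp (x j))]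
      refine Finset.sum_congr rfl fun j _ => ?_
      rw [hy0]; split_ifs <;> simp
    have hfd := ((HasDerivAt.fun_sum (u := 𝓣) fun T hT =>
      ((hSd T).log (hSpos T hT _).ne').const_mul (w T)).fun_sub
        (hsumd.const_mul c)).fun_add (hsumd.fun_pow 2)
    have h0 := hmin.hasDerivAt_eq_zero hfd
    simp only [hy0] at h0
    have : ∀ T ∈ 𝓣, (if i ∈ T then w T * (p T i * Real.exp (x i) / S T x) else 0) =
        w T * ((if i ∈ T then p T i * Real.exp (x i) else 0) / S T x) := by
      intro T _; split_ifs <;> simp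
    rw [Finset.sum_filter, Finset.sum_congr rfl this]
    push_cast at h0
    linarith
  have htot : ∑ i, ∑ T ∈ 𝓣 with i ∈ T, w T * (p T i * Real.exp (x i) / S T x) =
      Fintype.card ι * c := by
    have h1 := havg fun _ => 1
    simp only [Finset.sum_const, nsmul_eq_mul, mul_one, Finset.card_univ] at h1
    rw [mul_comm, ← h1]
    simp only [Finset.sum_filter]
    rw [Finset.sum_comm]
    refine Finset.sum_congr rfl fun T hT => ?_
    rw [Finset.sum_ite_mem, Finset.univ_inter, ← Finset.mul_sum, ← Finset.sum_div, hcard T hT]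
    have : (∑ j ∈ T, p T j * Real.exp (x j)) / S T x = 1 := div_self (hSpos T hT x).ne'
    rw [this]; norm_num
  have hzero : ∑ k, x k = 0 := by
    have h1 : ∑ i : ι, (∑ T ∈ 𝓣 with i ∈ T, w T * (p T i * Real.exp (x i) / S T x)
      - c + 2 * ∑ k, x k) = 0 := Finset.sum_eq_zero fun i _ => hderiv i
    rw [Finset.sum_add_distrib, Finset.sum_sub_distrib, htot] at h1
    simp only [Finset.sum_const, nsmul_eq_mul, Finset.card_univ] at h1
    have h2 : (Fintype.card ι : ℝ) * (2 * ∑ k, x k) = 0 := by linarith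
    rcases mul_eq_zero.1 h2 with h | h <;> linarith
  refine ⟨x, fun i => ?_⟩
  have := hderiv i
  rw [hzero] at this
  linarith

/-- A finite complex Sylvester–Gallai configuration spans a space of bounded dimension. -/
theorem finrank_span_le_of_sylvesterGallai {E ι : Type*} [AddCommGroup E] [Module ℂ E]
    [Fintype ι] (v : ι → E) (hind : ∀ i j, i ≠ j → LinearIndependent ℂ ![v i, v j])
    (hsg : ∀ i j, i ≠ j → ∃ k, k ≠ i ∧ k ≠ j ∧ v k ∈ Submodule.span ℂ {v i, v j}) :
    Module.finrank ℂ (Submodule.span ℂ (Set.range v)) ≤ 12 := by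
  classical
  by_cases hcard : Fintype.card ι ≤ 12
  · exact (finrank_range_le_card v).trans hcard
  push Not at hcard
  have hn : (13 : ℝ) ≤ Fintype.card ι := by exact_mod_cast hcard
  have : Nonempty ι := Fintype.card_pos_iff.1 (by omega)
  have hfin2 : ∀ i j, i ≠ j → Module.finrank ℂ (Submodule.span ℂ {v i, v j}) = 2 := by
    intro i j hij
    have := finrank_span_eq_card (hind i j hij)
    rwa [Fintype.card_fin, Matrix.range_cons_cons_empty] at this
  set 𝓣 : Finset (Finset ι) := Finset.univ.filter fun T =>
    T.card = 3 ∧ Module.finrank ℂ (Submodule.span ℂ (v '' (T : Set ι))) = 2 with h𝓣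
  have hmem : ∀ T, T ∈ 𝓣 ↔ T.card = 3 ∧
      Module.finrank ℂ (Submodule.span ℂ (v '' (T : Set ι))) = 2 := fun T => by simp [h𝓣]
  have hspan : ∀ T ∈ 𝓣, ∀ i ∈ T, ∀ j ∈ T, i ≠ j →
      Submodule.span ℂ {v i, v j} = Submodule.span ℂ (v '' (T : Set ι)) := by
    intro T hT i hi j hj hij
    have : FiniteDimensional ℂ (Submodule.span ℂ (v '' (T : Set ι))) :=
      FiniteDimensional.span_of_finite ℂ (T.finite_toSet.image v)
    refine Submodule.eq_of_le_of_finrank_le (Submodule.span_mono ?_) ?_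
    · rintro _ (rfl | rfl)
      exacts [⟨i, hi, rfl⟩, ⟨j, hj, rfl⟩]
    · rw [hfin2 i j hij, ((hmem T).1 hT).2]
  set line : Submodule ℂ E → Finset ι := fun W => Finset.univ.filter fun k => v k ∈ W with hline
  set w : Finset ι → ℝ := fun T =>
    1 / ((line (Submodule.span ℂ (v '' (T : Set ι)))).card - 2) with hw
  have hlinecard : ∀ i j, i ≠ j → 3 ≤ (line (Submodule.span ℂ {v i, v j})).card := by
    intro i j hij
    obtain ⟨k, hki, hkj, hk⟩ := hsg i j hij
    have : ({i, j, k} : Finset ι) ⊆ line (Submodule.span ℂ {v i, v j}) := by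
      intro m hm
      simp only [Finset.mem_insert, Finset.mem_singleton] at hm
      simp only [hline, Finset.mem_filter, Finset.mem_univ, true_and]
      rcases hm with rfl | rfl | rfl
      · exact Submodule.subset_span (by simp)
      · exact Submodule.subset_span (by simp)
      · exact hk
    have h3 : ({i, j, k} : Finset ι).card = 3 :=
      Finset.card_eq_three.2 ⟨i, j, k, hij, hki.symm, hkj.symm, rfl⟩
    exact h3 ▸ Finset.card_le_card this
  have hwpos : ∀ T ∈ 𝓣, 0 < w T := by
    intro T hT
    obtain ⟨i, j, k, hij, hik, hjk, hTe⟩ := Finset.card_eq_three.1 ((hmem T).1 hT).1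
    have h1 := hspan T hT i (by simp [hTe]) j (by simp [hTe]) hij
    have h2 : (3 : ℝ) ≤ (line (Submodule.span ℂ (v '' (T : Set ι)))).card := by
      rw [← h1]; exact_mod_cast hlinecard i j hij
    simp only [hw]
    exact one_div_pos.2 (by linarith)
  have htriple : ∀ i j k, i ≠ j → k ≠ i → k ≠ j → v k ∈ Submodule.span ℂ {v i, v j} →
      ({i, j, k} : Finset ι) ∈ 𝓣 := by
    intro i j k hij hki hkj hk
    refine (hmem _).2 ⟨Finset.card_eq_three.2 ⟨i, j, k, hij, hki.symm, hkj.symm, rfl⟩, ?_⟩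
    rw [← hfin2 i j hij]
    suffices h : Submodule.span ℂ (v '' (({i, j, k} : Finset ι) : Set ι)) =
        Submodule.span ℂ {v i, v j} by rw [h]
    refine le_antisymm (Submodule.span_le.2 ?_) (Submodule.span_mono ?_)
    · rintro _ ⟨m, hm, rfl⟩
      simp only [Finset.coe_insert, Finset.coe_singleton, Set.mem_insert_iff,
        Set.mem_singleton_iff] at hm
      rcases hm with rfl | rfl | rfl
      · exact Submodule.subset_span (by simp)
      · exact Submodule.subset_span (by simp)
      · exact hk
    · rintro _ (rfl | rfl)
      exacts [⟨i, by simp, rfl⟩, ⟨j, by simp, rfl⟩]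
  have hpair : ∀ i j, i ≠ j → ∑ T ∈ 𝓣 with i ∈ T ∧ j ∈ T, w T = 1 := by
    intro i j hij
    set r := (line (Submodule.span ℂ {v i, v j})).card with hr
    have h1 : ∀ T ∈ 𝓣.filter (fun T => i ∈ T ∧ j ∈ T), w T = 1 / ((r : ℝ) - 2) := by
      intro T hT
      obtain ⟨hT, hi, hj⟩ := Finset.mem_filter.1 hT
      simp only [hw, ← hspan T hT i hi j hj hij, hr]
    have hil : i ∈ line (Submodule.span ℂ {v i, v j}) := by
      simpa [hline] using Submodule.subset_span (by simp)
    have hjl : j ∈ (line (Submodule.span ℂ {v i, v j})).erase i := by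
      simpa [hline, hij.symm] using Submodule.subset_span (by simp)
    have h2 : 𝓣.filter (fun T => i ∈ T ∧ j ∈ T) =
        (((line (Submodule.span ℂ {v i, v j})).erase i).erase j).image
          (fun k => ({i, j, k} : Finset ι)) := by
      ext T
      simp only [Finset.mem_filter, Finset.mem_image, Finset.mem_erase]
      constructor
      · rintro ⟨hT, hi, hj⟩
        have hc : ((T.erase i).erase j).card = 1 := by
          rw [Finset.card_erase_of_mem (Finset.mem_erase.2 ⟨hij.symm, hj⟩),
            Finset.card_erase_of_mem hi, ((hmem T).1 hT).1]
        obtain ⟨k, hk⟩ := Finset.card_eq_one.1 hc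
        have hkm : k ∈ (T.erase i).erase j := by rw [hk]; simp
        simp only [Finset.mem_erase] at hkm
        refine ⟨k, ⟨hkm.1, hkm.2.1, ?_⟩, ?_⟩
        · simp only [hline, Finset.mem_filter, Finset.mem_univ, true_and]
          rw [hspan T hT i hi j hj hij]
          exact Submodule.subset_span ⟨k, hkm.2.2, rfl⟩
        · have h3 : insert j ((T.erase i).erase j) = T.erase i :=
            Finset.insert_erase (Finset.mem_erase.2 ⟨hij.symm, hj⟩)
          rw [hk] at h3
          rw [h3, Finset.insert_erase hi]
      · rintro ⟨k, ⟨hkj, hki, hk⟩, rfl⟩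
        exact ⟨htriple i j k hij hki hkj (by simpa [hline] using hk), by simp, by simp⟩
    have h3 : (𝓣.filter (fun T => i ∈ T ∧ j ∈ T)).card = r - 2 := by
      rw [h2, Finset.card_image_of_injOn, Finset.card_erase_of_mem hjl,
        Finset.card_erase_of_mem hil]
      · omega
      · intro k hk k' hk' h
        simp only [Finset.coe_erase, Set.mem_sdiff, Set.mem_singleton_iff] at hk hk'
        have : k ∈ ({i, j, k'} : Finset ι) := by
          have h' : ({i, j, k} : Finset ι) = {i, j, k'} := h
          rw [← h']; simp
        simpa [hk.1.2, hk.2] using this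
    have hr3 : 3 ≤ r := hlinecard i j hij
    have hr3' : (3 : ℝ) ≤ r := by exact_mod_cast hr3
    rw [Finset.sum_congr rfl h1, Finset.sum_const, h3, nsmul_eq_mul, Nat.cast_sub (by omega)]
    push_cast
    rw [mul_one_div, div_self (by linarith)]
  set c : ℝ := ((Fintype.card ι : ℝ) - 1) / 6 with hc
  have hmarg : ∀ i, ∑ T ∈ 𝓣 with i ∈ T, w T = 3 * c := by
    intro i
    have h1 : ∑ j ∈ Finset.univ.erase i, ∑ T ∈ 𝓣 with i ∈ T ∧ j ∈ T, w T =
        (Fintype.card ι : ℝ) - 1 := by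
      rw [Finset.sum_congr rfl fun j hj => hpair i j (Finset.ne_of_mem_erase hj).symm]
      rw [Finset.sum_const, Finset.card_erase_of_mem (Finset.mem_univ i), nsmul_eq_mul, mul_one,
        Nat.cast_sub (by rw [Finset.card_univ]; omega), Finset.card_univ]
      simp
    have h2 : ∑ j ∈ Finset.univ.erase i, ∑ T ∈ 𝓣 with i ∈ T ∧ j ∈ T, w T =
        ∑ T ∈ 𝓣 with i ∈ T, 2 * w T := by
      simp only [← Finset.filter_filter]
      simp only [Finset.sum_filter (s := 𝓣.filter fun T => i ∈ T)]
      rw [Finset.sum_comm]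
      refine Finset.sum_congr rfl fun T hT => ?_
      obtain ⟨hT, hi⟩ := Finset.mem_filter.1 hT
      rw [Finset.sum_ite_mem, Finset.sum_const, Finset.erase_inter, Finset.univ_inter,
        Finset.card_erase_of_mem hi, ((hmem T).1 hT).1]
      simp
    rw [h1, ← Finset.mul_sum] at h2
    rw [hc]; linarith
  have hdep : ∀ T ∈ 𝓣, ∃ a : ι → ℂ, (∀ i ∈ T, a i ≠ 0) ∧ (∀ i ∉ T, a i = 0) ∧
      ∑ i, a i • v i = 0 := by
    intro T hT
    obtain ⟨i, j, k, hij, hik, hjk, hTe⟩ := Finset.card_eq_three.1 ((hmem T).1 hT).1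
    have hk : v k ∈ Submodule.span ℂ {v i, v j} := by
      rw [hspan T hT i (by simp [hTe]) j (by simp [hTe]) hij]
      exact Submodule.subset_span ⟨k, by simp [hTe], rfl⟩
    obtain ⟨α, β, hαβ⟩ := Submodule.mem_span_pair.1 hk
    have hα : α ≠ 0 := by
      rintro rfl
      have := (LinearIndependent.pair_iff.1 (hind j k hjk) β (-1) (by rw [← hαβ]; simp)).2
      simp at this
    have hβ : β ≠ 0 := by
      rintro rfl
      have := (LinearIndependent.pair_iff.1 (hind i k hik) α (-1) (by rw [← hαβ]; simp)).2
      simp at this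
    refine ⟨fun m => if m = i then α else if m = j then β else if m = k then -1 else 0,
      ?_, ?_, ?_⟩
    · intro m hm
      rw [hTe] at hm
      simp only [Finset.mem_insert, Finset.mem_singleton] at hm
      rcases hm with rfl | rfl | rfl
      · simpa using hα
      · simpa [hij.symm] using hβ
      · simp [hik.symm, hjk.symm]
    · intro m hm
      rw [hTe] at hm
      simp only [Finset.mem_insert, Finset.mem_singleton, not_or] at hm
      simp [hm.1, hm.2.1, hm.2.2]
    · rw [← Finset.sum_subset (Finset.subset_univ ({i, j, k} : Finset ι))]
      · rw [Finset.sum_insert (by simp [hij, hik]), Finset.sum_insert (by simp [hjk]),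
          Finset.sum_singleton]
        simp only [if_true, hij.symm, hik.symm, hjk.symm, if_false]
        rw [← hαβ]
        module
      · intro m _ hm
        simp only [Finset.mem_insert, Finset.mem_singleton, not_or] at hm
        simp [hm.1, hm.2.1, hm.2.2]
  choose! a ha ha0 hasum using hdep
  obtain ⟨x, hx⟩ := exists_exp_scaling 𝓣 w (fun T i => ‖a T i‖ ^ 2) c hwpos
    (fun T hT => ((hmem T).1 hT).1) (fun T hT i hi => by have := ha T hT i hi; positivity)
    (fun i j hij => by
      obtain ⟨k, hki, hkj, hk⟩ := hsg i j hij
      exact ⟨{i, j, k}, htriple i j k hij hki hkj hk, by simp, by simp⟩) hmarg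
  set S : Finset ι → ℝ := fun T => ∑ j ∈ T, ‖a T j‖ ^ 2 * Real.exp (x j) with hS
  have hSpos : ∀ T ∈ 𝓣, 0 < S T := fun T hT =>
    Finset.sum_pos (fun i hi => by have := ha T hT i hi; positivity)
      (Finset.card_pos.1 (by rw [((hmem T).1 hT).1]; norm_num))
  set b : Finset ι → ι → ℂ := fun T i => a T i * (Real.exp (x i / 2) : ℂ) / (√(S T) : ℂ) with hb
  have hbn : ∀ T ∈ 𝓣, ∀ i, ‖b T i‖ ^ 2 = ‖a T i‖ ^ 2 * Real.exp (x i) / S T := by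
    intro T hT i
    simp only [hb, norm_div, norm_mul, Complex.norm_real, div_pow, mul_pow, Real.norm_eq_abs,
      sq_abs, Real.sq_sqrt (hSpos T hT).le]
    rw [← Real.exp_nat_mul]
    congr 3
    push_cast; ring
  set F := Submodule.span ℂ (Set.range v) with hF
  let v' : ι → F := fun i => ⟨v i, Submodule.subset_span ⟨i, rfl⟩⟩
  let Φ : Module.Dual ℂ F →ₗ[ℂ] EuclideanSpace ℂ ι :=
    (WithLp.linearEquiv 2 ℂ (ι → ℂ)).symm.toLinearMap ∘ₗ
      LinearMap.pi fun i => (Real.exp (-(x i / 2)) : ℂ) • Module.Dual.eval ℂ F (v' i)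
  have hΦ : ∀ φ i, Φ φ i = (Real.exp (-(x i / 2)) : ℂ) * φ (v' i) := fun φ i => rfl
  have hΦinj : Function.Injective Φ := by
    rw [← LinearMap.ker_eq_bot, LinearMap.ker_eq_bot']
    intro φ hφ
    refine LinearMap.ext_on (Submodule.span_span_coe_preimage (s := Set.range v)) ?_
    rintro ⟨y, hy⟩ ⟨i, hi⟩
    simp only at hi
    subst hi
    have := hΦ φ i
    rw [hφ] at this
    simp only [PiLp.zero_apply] at this
    rcases mul_eq_zero.1 this.symm with h | h
    · exact absurd h (by exact_mod_cast (Real.exp_pos _).ne')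
    · simpa using h
  have : FiniteDimensional ℂ F := FiniteDimensional.span_of_finite ℂ (Set.finite_range v)
  have hrank : Module.finrank ℂ (LinearMap.range Φ) = Module.finrank ℂ F := by
    rw [LinearMap.finrank_range_of_inj hΦinj, Subspace.dual_finrank_eq]
  have hmain := finrank_mul_sq_le_of_doubly_scaled (LinearMap.range Φ) 𝓣 w b c
    (fun T hT => (hwpos T hT).le) (fun T hT i hi => by simp [hb, ha0 T hT i hi])
    (fun T hT => by
      rw [Finset.sum_congr rfl fun i _ => hbn T hT i, ← Finset.sum_div]
      rw [← Finset.sum_subset (Finset.subset_univ T)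
        (fun i _ hi => by simp [ha0 T hT i hi])]
      exact div_self (hSpos T hT).ne')
    (fun i => by
      rw [← hx i, Finset.sum_filter (s := 𝓣)]
      refine Finset.sum_congr rfl fun T hT => ?_
      rw [hbn T hT i]
      split_ifs with h
      · rfl
      · simp [ha0 T hT i h])
    (fun i j hij => (hpair i j hij).le)
    (by
      rintro _ ⟨φ, rfl⟩ T hT
      have h1 : ∀ i, b T i * Φ φ i = (1 / (√(S T) : ℂ)) * (a T i * φ (v' i)) := by
        intro i
        have h2 : (Real.exp (x i / 2) : ℂ) * (Real.exp (-(x i / 2)) : ℂ) = 1 := by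
          rw [← Complex.ofReal_mul, ← Real.exp_add]; simp
        rw [hΦ]
        simp only [hb]
        linear_combination (a T i * φ (v' i) / (√(S T) : ℂ)) * h2
      rw [Finset.sum_congr rfl fun i _ => h1 i, ← Finset.mul_sum]
      have h3 : ∑ i, a T i • v' i = 0 := by
        apply Subtype.ext
        simpa [v'] using hasum T hT
      have h4 := congrArg φ h3
      simp only [map_sum, map_smul, smul_eq_mul, map_zero] at h4
      rw [h4, mul_zero])
  rw [hrank] at hmain
  have hcpos : 0 < c := by rw [hc]; linarith
  have h1 : (Module.finrank ℂ F : ℝ) * c ≤ Fintype.card ι := by nlinarith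
  have h2 : (Module.finrank ℂ F : ℝ) ≤ 12 := by
    by_contra h
    push Not at h
    have : 12 * c < Module.finrank ℂ F * c := by nlinarith
    rw [hc] at this h1
    linarith
  exact_mod_cast h2

/-- Substitution killing `ℓ₁` and `ℓ₂` and fixing a space `V` of linear forms independent of
them; it kills every polynomial vanishing on `ℓ₁ = ℓ₂ = 0`. -/
theorem exists_algHom_of_disjoint_span_pair {σ : Type*} {ℓ₁ ℓ₂ : MvPolynomial σ ℂ}
    (h₁ : ℓ₁.IsHomogeneous 1) (h₂ : ℓ₂.IsHomogeneous 1)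
    {V : Submodule ℂ (MvPolynomial σ ℂ)} (hV : V ≤ homogeneousSubmodule σ ℂ 1)
    (hdisj : Disjoint V (Submodule.span ℂ {ℓ₁, ℓ₂})) :
    ∃ φ : MvPolynomial σ ℂ →ₐ[ℂ] MvPolynomial σ ℂ,
      (∀ ℓ : MvPolynomial σ ℂ, ℓ.IsHomogeneous 1 → ℓ - φ ℓ ∈ Submodule.span ℂ {ℓ₁, ℓ₂}) ∧
      (∀ ℓ ∈ V, φ ℓ = ℓ) ∧ φ ℓ₁ = 0 ∧ φ ℓ₂ = 0 ∧
      ∀ P : MvPolynomial σ ℂ,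
        (∀ x : σ → ℂ, eval x ℓ₁ = 0 → eval x ℓ₂ = 0 → eval x P = 0) → φ P = 0 := by
  obtain ⟨W, hVW, hW⟩ := hdisj.exists_isCompl
  set θ := Submodule.projection W _ hW with hθ
  set φ : MvPolynomial σ ℂ →ₐ[ℂ] MvPolynomial σ ℂ := aeval fun i => θ (X i) with hφ
  have hlin : ∀ ℓ : MvPolynomial σ ℂ, ℓ.IsHomogeneous 1 → φ ℓ = θ ℓ := by
    intro ℓ hℓ
    have hℓ' : ℓ ∈ Submodule.span ℂ (Set.range X) := by
      rw [← homogeneousSubmodule_one_eq_span_X]; exact hℓ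
    exact LinearMap.eqOn_span (f := φ.toLinearMap) (g := θ)
      (by rintro _ ⟨i, rfl⟩; simp [hφ]) hℓ'
  have hφ₁ : φ ℓ₁ = 0 := by
    rw [hlin _ h₁, hθ, Submodule.projection_apply_eq_zero_iff]
    exact Submodule.subset_span (by simp)
  have hφ₂ : φ ℓ₂ = 0 := by
    rw [hlin _ h₂, hθ, Submodule.projection_apply_eq_zero_iff]
    exact Submodule.subset_span (by simp)
  refine ⟨φ, fun ℓ hℓ => ?_, fun ℓ hℓ => ?_, hφ₁, hφ₂, fun P hP => ?_⟩
  · rw [hlin ℓ hℓ]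
    exact Submodule.sub_projection_mem hW ℓ
  · rw [hlin ℓ (hV hℓ)]
    exact Submodule.projection_apply_of_mem_left hW (hVW hℓ)
  · refine funext fun x => ?_
    have heval : ∀ R : MvPolynomial σ ℂ, eval x (φ R) = eval (fun i => eval x (θ (X i))) R := by
      intro R
      induction R using MvPolynomial.induction_on with
      | C a => simp [hφ]
      | add p q hp hq => simp [hp, hq]
      | mul_X p i hp => rw [map_mul, map_mul, map_mul, hp]; simp [hφ]
    rw [heval, map_zero]
    refine hP _ ?_ ?_
    · rw [← heval, hφ₁, map_zero]
    · rw [← heval, hφ₂, map_zero]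

theorem exists_eq_mul_add_mul_of_algHom_eq_zero {σ : Type*} {ℓ₁ ℓ₂ : MvPolynomial σ ℂ}
    (h₁ : ℓ₁.IsHomogeneous 1) (h₂ : ℓ₂.IsHomogeneous 1)
    (φ : MvPolynomial σ ℂ →ₐ[ℂ] MvPolynomial σ ℂ)
    (hφ : ∀ ℓ : MvPolynomial σ ℂ, ℓ.IsHomogeneous 1 → ℓ - φ ℓ ∈ Submodule.span ℂ {ℓ₁, ℓ₂})
    {P : MvPolynomial σ ℂ} (hP : P.IsHomogeneous 2) (hφP : φ P = 0) :
    ∃ a b : MvPolynomial σ ℂ, a.IsHomogeneous 1 ∧ b.IsHomogeneous 1 ∧ P = ℓ₁ * a + ℓ₂ * b := by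
  have hspan : Submodule.span ℂ {ℓ₁, ℓ₂} ≤ homogeneousSubmodule σ ℂ 1 := by
    rw [Submodule.span_le]
    rintro _ (rfl | rfl)
    exacts [h₁, h₂]
  have hmem : P ∈ homogeneousSubmodule σ ℂ 1 * homogeneousSubmodule σ ℂ 1 := by
    rw [← pow_two, homogeneousSubmodule_one_pow]; exact hP
  have key : ∃ a ∈ homogeneousSubmodule σ ℂ 1, ∃ b ∈ homogeneousSubmodule σ ℂ 1,
      P - φ P = ℓ₁ * a + ℓ₂ * b := by
    clear hφP hP
    induction hmem using Submodule.mul_induction_on' with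
    | mem_mul_mem m hm n hn =>
      obtain ⟨α, β, hαβ⟩ := Submodule.mem_span_pair.1 (hφ m hm)
      obtain ⟨γ, δ, hγδ⟩ := Submodule.mem_span_pair.1 (hφ n hn)
      have hφm : φ m ∈ homogeneousSubmodule σ ℂ 1 := by
        have := Submodule.sub_mem _ hm (hspan (hφ m hm))
        simpa using this
      refine ⟨α • n + γ • φ m, Submodule.add_mem _ (Submodule.smul_mem _ _ hn)
        (Submodule.smul_mem _ _ hφm), β • n + δ • φ m, Submodule.add_mem _
        (Submodule.smul_mem _ _ hn) (Submodule.smul_mem _ _ hφm), ?_⟩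
      have : m * n - φ (m * n) = (m - φ m) * n + φ m * (n - φ n) := by rw [map_mul]; ring
      rw [this, ← hαβ, ← hγδ]
      simp only [smul_eq_C_mul]
      ring
    | add x _ y _ hx hy =>
      obtain ⟨a, ha, b, hb, h⟩ := hx
      obtain ⟨a', ha', b', hb', h'⟩ := hy
      refine ⟨a + a', Submodule.add_mem _ ha ha', b + b', Submodule.add_mem _ hb hb', ?_⟩
      rw [map_add]
      linear_combination h + h'
  obtain ⟨a, ha, b, hb, h⟩ := key
  exact ⟨a, b, ha, hb, by rwa [hφP, sub_zero] at h⟩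

theorem not_vanishing_of_mem_span_of_disjoint {σ : Type*} {ℓ₁ ℓ₂ P : MvPolynomial σ ℂ}
    {I : Set (MvPolynomial σ ℂ)} {V : Submodule ℂ (MvPolynomial σ ℂ)}
    (h₁ : ℓ₁.IsHomogeneous 1) (h₂ : ℓ₂.IsHomogeneous 1)
    (hV : V ≤ homogeneousSubmodule σ ℂ 1)
    (hdisj : Disjoint V (Submodule.span ℂ {ℓ₁, ℓ₂}))
    (hI : ∀ G ∈ Submodule.span ℂ I, G ≠ 0 →
      ¬ ∃ x a y b : MvPolynomial σ ℂ, x.IsHomogeneous 1 ∧ a.IsHomogeneous 1 ∧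
        y.IsHomogeneous 1 ∧ b.IsHomogeneous 1 ∧
        ∃ F ∈ Submodule.span ℂ {u : MvPolynomial σ ℂ | ∃ v ∈ V, ∃ w ∈ V, u = v * w},
          G = x * a + y * b + F)
    (hP : P.IsHomogeneous 2) (hP0 : P ≠ 0)
    (hPI : P ∈ Submodule.span ℂ (I ∪ {u | ∃ v ∈ V, ∃ w ∈ V, u = v * w})) :
    ¬ ∀ x : σ → ℂ, eval x ℓ₁ = 0 → eval x ℓ₂ = 0 → eval x P = 0 := by
  intro hvan
  obtain ⟨φ, hφ, hφV, -, -, hφvan⟩ := exists_algHom_of_disjoint_span_pair h₁ h₂ hV hdisj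
  have hφP := hφvan P hvan
  obtain ⟨a, b, ha, hb, hab⟩ := exists_eq_mul_add_mul_of_algHom_eq_zero h₁ h₂ φ hφ hP hφP
  rw [Submodule.span_union] at hPI
  obtain ⟨G, hG, F, hF, hGF⟩ := Submodule.mem_sup.1 hPI
  have hG0 : G = 0 := by
    by_contra hne
    refine hI G hG hne ⟨ℓ₁, a, ℓ₂, b, h₁, ha, h₂, hb, -F, Submodule.neg_mem _ hF, ?_⟩
    rw [← hab, ← hGF]; ring
  have hφF : φ F = F :=
    LinearMap.eqOn_span (f := φ.toLinearMap) (g := LinearMap.id)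
      (by
        rintro _ ⟨v, hv, w, hw, rfl⟩
        simp [hφV v hv, hφV w hw]) hF
  rw [hG0, zero_add] at hGF
  rw [hGF] at hφF
  exact hP0 (hφF.symm.trans hφP)

theorem finrank_le_finrank_add_finrank_map_mkQ {K E : Type*} [DivisionRing K] [AddCommGroup E]
    [Module K E] (U V : Submodule K E) [FiniteDimensional K U] [FiniteDimensional K V] :
    Module.finrank K U ≤ Module.finrank K V + Module.finrank K (U.map V.mkQ) := by
  have h := (V.mkQ.domRestrict U).finrank_range_add_finrank_ker
  rw [LinearMap.range_domRestrict] at h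
  have h2 : Module.finrank K (LinearMap.ker (V.mkQ.domRestrict U)) ≤ Module.finrank K V := by
    have hmem : ∀ x : LinearMap.ker (V.mkQ.domRestrict U), (x : U).1 ∈ V := fun x => by
      have := x.2
      rwa [LinearMap.mem_ker, LinearMap.domRestrict_apply, Submodule.mkQ_apply,
        Submodule.Quotient.mk_eq_zero] at this
    refine LinearMap.finrank_le_finrank_of_injective
      (f := (U.subtype ∘ₗ Submodule.subtype _).codRestrict V hmem) ?_
    intro x y hxy
    exact Subtype.ext (Subtype.ext (congrArg (Subtype.val : V → E) hxy))
  omega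

theorem Projectivization.mem_span_rep {K E : Type*} [DivisionRing K] [AddCommGroup E]
    [Module K E] {z : E} (hz : z ≠ 0) : z ∈ Submodule.span K {(mk K z hz).rep} := by
  rw [← submodule_eq, submodule_mk]
  exact Submodule.mem_span_singleton_self z

theorem Projectivization.rep_mk_mem_span {K E : Type*} [DivisionRing K] [AddCommGroup E]
    [Module K E] {z : E} (hz : z ≠ 0) : (mk K z hz).rep ∈ Submodule.span K {z} := by
  rw [← submodule_mk z hz, submodule_eq]
  exact Submodule.mem_span_singleton_self _

/-- Version of `finrank_span_le_of_sylvesterGallai` for finite sets in which proportional vectors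
are allowed. -/
theorem finrank_span_le_of_sylvesterGallai_of_finite {E : Type*} [AddCommGroup E] [Module ℂ E]
    {S : Set E} (hS : S.Finite)
    (hsg : ∀ y ∈ S, ∀ z ∈ S, LinearIndependent ℂ ![y, z] →
      ∃ α β : ℂ, α ≠ 0 ∧ β ≠ 0 ∧ α • y + β • z ∈ S) :
    Module.finrank ℂ (Submodule.span ℂ S) ≤ 12 := by
  set Z : Set (Projectivization ℂ E) := {p | ∃ z ∈ S, ∃ hz : z ≠ 0, p = .mk ℂ z hz} with hZ
  have hZfin : Z.Finite := by
    have : Finite {z : E // z ∈ S ∧ z ≠ 0} := (hS.subset fun _ h => h.1).to_subtype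
    refine (Set.finite_range
      fun z : {z : E // z ∈ S ∧ z ≠ 0} => Projectivization.mk ℂ z.1 z.2.2).subset ?_
    rintro _ ⟨z, hzS, hz, rfl⟩
    exact ⟨⟨z, hzS, hz⟩, rfl⟩
  have : Fintype Z := hZfin.fintype
  have hspan : Submodule.span ℂ S ≤ Submodule.span ℂ (Set.range fun i : Z => i.1.rep) := by
    rw [Submodule.span_le]
    intro z hzS
    by_cases hz : z = 0
    · rw [hz]; exact Submodule.zero_mem _
    refine Submodule.span_mono ?_ (Projectivization.mem_span_rep (K := ℂ) hz)
    rintro _ rfl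
    exact ⟨⟨_, z, hzS, hz, rfl⟩, rfl⟩
  have hfd : FiniteDimensional ℂ (Submodule.span ℂ (Set.range fun i : Z => i.1.rep)) :=
    FiniteDimensional.span_of_finite ℂ (Set.finite_range _)
  refine (Submodule.finrank_mono hspan).trans
    (finrank_span_le_of_sylvesterGallai _ (fun i j hij => ?_) ?_)
  · exact Projectivization.linearIndependent_pair_iff_ne.2 fun h => hij (Subtype.ext h)
  · rintro ⟨_, y, hyS, hy, rfl⟩ ⟨_, z, hzS, hz, rfl⟩ hij
    have hlin : LinearIndependent ℂ ![y, z] := by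
      rw [← Projectivization.independent_mk_iff_LinearIndependent hy hz,
        Projectivization.independent_pair_iff_ne]
      exact fun h => hij (Subtype.ext h)
    obtain ⟨α, β, hα, hβ, hmem⟩ := hsg y hyS z hzS hlin
    rw [LinearIndependent.pair_iff] at hlin
    have hne : α • y + β • z ≠ 0 := fun h => hα (hlin α β h).1
    refine ⟨⟨_, _, hmem, hne, rfl⟩, ?_, ?_, ?_⟩
    · intro h
      obtain ⟨t, ht⟩ := (Projectivization.mk_eq_mk_iff' ℂ _ _ _ _).1 (congrArg Subtype.val h)
      refine hβ (hlin (α - t) β ?_).2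
      rw [sub_smul, ht]; abel
    · intro h
      obtain ⟨t, ht⟩ := (Projectivization.mk_eq_mk_iff' ℂ _ _ _ _).1 (congrArg Subtype.val h)
      refine hα (hlin α (β - t) ?_).1
      rw [sub_smul, ht]; abel
    · refine (Submodule.span_singleton_le_iff_mem _ _).2 ?_ (Projectivization.rep_mk_mem_span hne)
      refine Submodule.add_mem _ (Submodule.smul_mem _ _ ?_) (Submodule.smul_mem _ _ ?_)
      · exact Submodule.span_mono (by simp) (Projectivization.mem_span_rep (K := ℂ) hy)
      · exact Submodule.span_mono (by simp) (Projectivization.mem_span_rep (K := ℂ) hz)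


/-- There is an absolute constant `C` such that the following holds. Let `𝒬 ∪ ℒ` be a
finite Sylvester–Gallai configuration of pairwise linearly independent homogeneous
quadratics, where every element of `𝒬` is irreducible and every element of `ℒ` is a
square of a linear form. Suppose there are a finite set `ℐ` of quadratics and a subspace
`V` of linear forms such that every element of `𝒬` lies in the span of `ℐ` together with
the quadratics over `V`, and no nonzero linear combination of the elements of `ℐ` can be
written as `x·a + y·b + F` with `x, a, y, b` linear forms and `F` a quadratic over `V`.
Then the span of the linear forms whose squares lie in `ℒ` has dimension at most
`dim V + C`. -/
theorem stmt_14 :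
    ∃ C : ℕ, ∀ (n : ℕ) (Q L : Finset (MvPolynomial (Fin n) ℂ)),
      (∀ P ∈ Q ∪ L, P.IsHomogeneous 2) →
      (∀ P ∈ Q ∪ L, ∀ P' ∈ Q ∪ L, P ≠ P' → LinearIndependent ℂ ![P, P']) →
      (∀ P1 ∈ Q ∪ L, ∀ P2 ∈ Q ∪ L, P1 ≠ P2 → ∃ P3 ∈ Q ∪ L, P3 ≠ P1 ∧ P3 ≠ P2 ∧
        ∀ a : Fin n → ℂ, eval a P1 = 0 → eval a P2 = 0 → eval a P3 = 0) →
      (∀ P ∈ Q, Irreducible P) →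
      (∀ P ∈ L, ∃ ℓ : MvPolynomial (Fin n) ℂ, ℓ.IsHomogeneous 1 ∧ P = ℓ ^ 2) →
      ∀ (I : Finset (MvPolynomial (Fin n) ℂ)) (V : Submodule ℂ (MvPolynomial (Fin n) ℂ)),
      (∀ G ∈ I, G.IsHomogeneous 2) →
      V ≤ homogeneousSubmodule (Fin n) ℂ 1 →
      (∀ P ∈ Q, P ∈ Submodule.span ℂ
        ((I : Set (MvPolynomial (Fin n) ℂ)) ∪
          {x | ∃ v ∈ V, ∃ w ∈ V, x = v * w})) →
      (∀ G ∈ Submodule.span ℂ (I : Set (MvPolynomial (Fin n) ℂ)), G ≠ 0 →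
        ¬ ∃ x a y b : MvPolynomial (Fin n) ℂ, x.IsHomogeneous 1 ∧ a.IsHomogeneous 1 ∧
          y.IsHomogeneous 1 ∧ b.IsHomogeneous 1 ∧
          ∃ F ∈ Submodule.span ℂ
            {u : MvPolynomial (Fin n) ℂ | ∃ v ∈ V, ∃ w ∈ V, u = v * w},
            G = x * a + y * b + F) →
      Module.finrank ℂ
        ↥(Submodule.span ℂ
          {ℓ : MvPolynomial (Fin n) ℂ | ℓ.IsHomogeneous 1 ∧ ℓ ^ 2 ∈ L}) ≤
        Module.finrank ℂ ↥V + C := by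
  refine ⟨12, fun n Q L hhom hind hsg hirr hsq I V _ hV hQ hI => ?_⟩
  set S : Set (MvPolynomial (Fin n) ℂ) := {ℓ | ℓ.IsHomogeneous 1 ∧ ℓ ^ 2 ∈ L} with hS
  have hH : FiniteDimensional ℂ (homogeneousSubmodule (Fin n) ℂ 1) :=
    Module.Finite.iff_fg.2 (homogeneousSubmodule_fg _ _ 1)
  have hVfd : FiniteDimensional ℂ V := Submodule.finiteDimensional_of_le hV
  have hSfd : FiniteDimensional ℂ (Submodule.span ℂ S) :=
    Submodule.finiteDimensional_of_le (S₂ := homogeneousSubmodule (Fin n) ℂ 1)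
      (Submodule.span_le.2 fun ℓ hℓ => hℓ.1)
  have hSfin : S.Finite := by
    choose! g hg using hsq
    refine ((L.finite_toSet.image g).union (L.finite_toSet.image fun P => -g P)).subset ?_
    rintro ℓ ⟨-, hℓ⟩
    rcases sq_eq_sq_iff_eq_or_eq_neg.1 (hg _ hℓ).2 with h | h
    · exact Or.inl ⟨_, hℓ, h.symm⟩
    · exact Or.inr ⟨_, hℓ, h.symm⟩
  refine (finrank_le_finrank_add_finrank_map_mkQ _ V).trans (Nat.add_le_add_left ?_ _)
  rw [Submodule.map_span]
  refine finrank_span_le_of_sylvesterGallai_of_finite (hSfin.image _) ?_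
  rintro _ ⟨ℓ₁, hℓ₁, rfl⟩ _ ⟨ℓ₂, hℓ₂, rfl⟩ hlin
  rw [LinearIndependent.pair_iff] at hlin
  have hdisj : Disjoint V (Submodule.span ℂ {ℓ₁, ℓ₂}) := by
    rw [Submodule.disjoint_def]
    intro ℓ hℓV hℓ
    obtain ⟨α, β, rfl⟩ := Submodule.mem_span_pair.1 hℓ
    obtain ⟨rfl, rfl⟩ := hlin α β (by
      rw [← map_smul, ← map_smul, ← map_add]
      exact (Submodule.Quotient.mk_eq_zero V).2 hℓV)
    simp
  have hmem₁ : ℓ₁ ^ 2 ∈ Q ∪ L := Finset.mem_union_right _ hℓ₁.2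
  have hmem₂ : ℓ₂ ^ 2 ∈ Q ∪ L := Finset.mem_union_right _ hℓ₂.2
  have hne : ℓ₁ ^ 2 ≠ ℓ₂ ^ 2 := by
    intro h
    rcases sq_eq_sq_iff_eq_or_eq_neg.1 h with h | h
    · simpa using hlin 1 (-1) (by rw [h]; simp)
    · simpa using hlin 1 1 (by rw [h]; simp)
  obtain ⟨P, hP, hP₁, hP₂, hvan⟩ := hsg _ hmem₁ _ hmem₂ hne
  have hvan' : ∀ x : Fin n → ℂ, eval x ℓ₁ = 0 → eval x ℓ₂ = 0 → eval x P = 0 :=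
    fun x h₁ h₂ => hvan x (by simp [h₁]) (by simp [h₂])
  rcases Finset.mem_union.1 hP with hPQ | hPL
  · exact absurd hvan' (not_vanishing_of_mem_span_of_disjoint hℓ₁.1 hℓ₂.1 hV hdisj hI
      (hhom P hP) (hirr P hPQ).ne_zero (hQ P hPQ))
  · obtain ⟨ℓ, hℓ, rfl⟩ := hsq P hPL
    obtain ⟨φ, hφ, -, -, -, hφvan⟩ :=
      exists_algHom_of_disjoint_span_pair hℓ₁.1 hℓ₂.1 hV hdisj
    have hφℓ : φ ℓ = 0 := by simpa using hφvan _ hvan'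
    have hspan := hφ ℓ hℓ
    rw [hφℓ, sub_zero] at hspan
    obtain ⟨α, β, rfl⟩ := Submodule.mem_span_pair.1 hspan
    refine ⟨α, β, ?_, ?_, ?_⟩
    · rintro rfl
      have h := LinearIndependent.pair_iff.1 (hind _ hP _ hmem₂ hP₂) 1 (-β ^ 2)
        (by simp [smul_pow])
      simp at h
    · rintro rfl
      have h := LinearIndependent.pair_iff.1 (hind _ hP _ hmem₁ hP₁) 1 (-α ^ 2)
        (by simp [smul_pow])
      simp at h
    · exact ⟨α • ℓ₁ + β • ℓ₂, ⟨hℓ, hPL⟩, by simp⟩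
end
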